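/- arXiv:1904.00989 — 2 statements merged into one kernel-verified Lean document; each statement's English description precedes it below -/
import Mathlib

section
/- Sharpness of the bounds as neighborhoods expand, implicit-dependence case (Theorem 4): under Assumptions Φ(i) and Φ(ii), if Condition S holds at (θ,γ0,P0) for every θ ∈ Θ and μ and F* are mutually absolutely continuous, then κ̲(N_δ) → inf K_# and κ̄(N_δ) → sup K_# as δ → ∞. -/
open MeasureTheory Filter Set
open scoped ENNReal Pointwise Classical

noncomputable section

namespace CFSens

/-- map an extended real to `ℝ≥0∞` (negatives go to `0`; only used on nonnegative values). -/
def erealToENNReal (x : EReal) : ℝ≥0∞ := if x = ⊤ then ⊤ else ENNReal.ofReal x.toReal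

/-- Euclidean dot product. -/
def dot {ι : Type*} [Fintype ι] (a b : ι → ℝ) : ℝ := ∑ i, a i * b i

/-- Convex conjugate `φ*(x) = sup_{t ≥ 0} (t x - φ t)` (`EReal`-valued). -/
def phiStar (φ : ℝ → ℝ) (x : ℝ) : EReal :=
  ⨆ t ∈ Set.Ici (0:ℝ), ((t * x - φ t : ℝ) : EReal)

/-- Convex conjugate `(ηφ)*(x) = sup_{t ≥ 0} (t x - η φ t)` of `ηφ`, for `η ≥ 0`. -/
def etaPhiStar (φ : ℝ → ℝ) (η x : ℝ) : EReal :=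
  ⨆ t ∈ Set.Ici (0:ℝ), ((t * x - η * φ t : ℝ) : EReal)

/-- `ψ(x) = φ*(x) - x`. -/
def psi (φ : ℝ → ℝ) (x : ℝ) : EReal := phiStar φ x - (x : EReal)

/-- Assumption Φ(i).  Here `φ : ℝ → ℝ` records the (finite) values of the divergence cost
on `[0,∞)`; the paper's extension `φ(x) = +∞` for `x < 0` is encoded separately wherever it
matters (nonnegativity of densities), and `φ(0) < ∞` is automatic since `φ` is real-valued. -/
structure PhiOne (φ : ℝ → ℝ) : Prop where
  smooth : ContDiffOn ℝ 2 φ (Set.Ioi (0:ℝ))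
  sconvex : StrictConvexOn ℝ (Set.Ici (0:ℝ)) φ
  one : φ 1 = 0
  done : deriv φ 1 = 0
  superlinear : Tendsto (fun x => φ x / x) atTop atTop
  dzero : ∃ L : EReal, L < 0 ∧
    Tendsto (fun x => ((deriv φ x : ℝ) : EReal)) (nhdsWithin 0 (Set.Ioi 0)) (nhds L)
  dinfty : ∃ L : EReal, 0 < L ∧ Tendsto (fun x => ((deriv φ x : ℝ) : EReal)) atTop (nhds L)
  delta2 : ∃ L : ℝ, Tendsto (fun x => x * deriv φ x / φ x) atTop (nhds L)

variable {U : Type*} [MeasurableSpace U] {dθ d1 d2 d3 d4 : ℕ} {Γ : Type*}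

/-- Stacked moment values/multipliers `(v1,v2,v3,v4)`. -/
abbrev Vec4 (d1 d2 d3 d4 : ℕ) :=
  (Fin d1 → ℝ) × (Fin d2 → ℝ) × (Fin d3 → ℝ) × (Fin d4 → ℝ)

/-- The targeted moments `P = (P1,P2)`. -/
abbrev Vec12 (d1 d2 : ℕ) := (Fin d1 → ℝ) × (Fin d2 → ℝ)

/-- `λ'g` for stacked vectors. -/
def dot4 (a b : Vec4 d1 d2 d3 d4) : ℝ :=
  dot a.1 b.1 + dot a.2.1 b.2.1 + dot a.2.2.1 b.2.2.1 + dot a.2.2.2 b.2.2.2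

/-- dot product on `Vec12`. -/
def dot12 (a b : Vec12 d1 d2) : ℝ := dot a.1 b.1 + dot a.2 b.2

/-- `λ ∈ Λ`, i.e. the multipliers on the inequality constraints are nonnegative. -/
def inLambda (l : Vec4 d1 d2 d3 d4) : Prop := (∀ i, 0 ≤ l.1 i) ∧ (∀ i, 0 ≤ l.2.2.1 i)

/-- `λ12'P`. -/
def dotP (l : Vec4 d1 d2 d3 d4) (P : Vec12 d1 d2) : ℝ := dot l.1 P.1 + dot l.2.1 P.2

/-- The φ-divergence `D_φ(F‖F*)` (`= +∞` unless `F ≪ F*`). -/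
def Dphi (φ : ℝ → ℝ) (Fstar F : Measure U) : ℝ≥0∞ :=
  if F ≪ Fstar then ∫⁻ u, ENNReal.ofReal (φ (F.rnDeriv Fstar u).toReal) ∂Fstar else ⊤

/-- Membership in the Orlicz heart `ℰ`: `∫ ψ(c|f|) dF* < ∞` for all `c > 0`. -/
def MemE (φ : ℝ → ℝ) (Fstar : Measure U) (f : U → ℝ) : Prop :=
  Measurable f ∧ ∀ c : ℝ, 0 < c → ∫⁻ u, erealToENNReal (psi φ (c * |f u|)) ∂Fstar < ⊤

/-- The Orlicz norm `‖f‖_ψ = inf_{c>0} c⁻¹ (1 + ∫ ψ(c|f|) dF*)`. -/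
def psiNorm (φ : ℝ → ℝ) (Fstar : Measure U) (f : U → ℝ) : ℝ≥0∞ :=
  ⨅ c ∈ Set.Ioi (0:ℝ),
    (ENNReal.ofReal c)⁻¹ * (1 + ∫⁻ u, erealToENNReal (psi φ (c * |f u|)) ∂Fstar)

/-- `E^{F*}[f]` for an `EReal`-valued integrand bounded below by `-c`. -/
def eExp (Fstar : Measure U) (c : ℝ) (f : U → EReal) : EReal :=
  ((∫⁻ u, erealToENNReal (f u + (c : EReal)) ∂Fstar : ℝ≥0∞) : EReal) - (c : EReal)

/-- Sequential lower hemicontinuity of a correspondence `A` (sequences taken in `S`). -/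
def LowerHemicontinuousAt {α β : Type*} [TopologicalSpace α] [TopologicalSpace β]
    (A : α → Set β) (S : Set α) (x : α) : Prop :=
  ∀ xs : ℕ → α, (∀ n, xs n ∈ S) → Tendsto xs atTop (nhds x) →
    ∀ y ∈ A x, ∃ ys : ℕ → β, (∀ n, ys n ∈ A (xs n)) ∧ Tendsto ys atTop (nhds y)

section Model

variable (φ : ℝ → ℝ) (Fstar : Measure U)
variable (g : U → (Fin dθ → ℝ) → Γ → Vec4 d1 d2 d3 d4)
variable (k : U → (Fin dθ → ℝ) → Γ → ℝ)

/-- All components of `g(·,θ,γ)` are integrable under `F`. -/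
def GIntegrable (θ : Fin dθ → ℝ) (γ : Γ) (F : Measure U) : Prop :=
  (∀ i, Integrable (fun u => (g u θ γ).1 i) F) ∧
  (∀ i, Integrable (fun u => (g u θ γ).2.1 i) F) ∧
  (∀ i, Integrable (fun u => (g u θ γ).2.2.1 i) F) ∧
  (∀ i, Integrable (fun u => (g u θ γ).2.2.2 i) F)

/-- The model constraints (1)–(4): `E^F[g1] ≤ P1`, `E^F[g2] = P2`, `E^F[g3] ≤ 0`, `E^F[g4] = 0`. -/
def ConstraintsHold (θ : Fin dθ → ℝ) (γ : Γ) (P : Vec12 d1 d2) (F : Measure U) : Prop :=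
  GIntegrable g θ γ F ∧
  (∀ i, ∫ u, (g u θ γ).1 i ∂F ≤ P.1 i) ∧
  (∀ i, ∫ u, (g u θ γ).2.1 i ∂F = P.2 i) ∧
  (∀ i, ∫ u, (g u θ γ).2.2.1 i ∂F ≤ 0) ∧
  (∀ i, ∫ u, (g u θ γ).2.2.2 i ∂F = 0)

/-- `F ∈ N_δ` and the model constraints hold at `(θ,γ,P)` under `F`. -/
def Feasible (δ : ℝ) (θ : Fin dθ → ℝ) (γ : Γ) (P : Vec12 d1 d2) (F : Measure U) : Prop :=
  IsProbabilityMeasure F ∧ Dphi φ Fstar F ≤ ENNReal.ofReal δ ∧ ConstraintsHold g θ γ P F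

/-- `κ̲_δ(θ;γ,P)`: primal lower value (explicit-dependence case); `= ⊤` if infeasible. -/
def kappaLow (δ : ℝ) (θ : Fin dθ → ℝ) (γ : Γ) (P : Vec12 d1 d2) : EReal :=
  sInf {x : EReal | ∃ F : Measure U, Feasible φ Fstar g δ θ γ P F ∧
    Integrable (fun u => k u θ γ) F ∧ x = ((∫ u, k u θ γ ∂F : ℝ) : EReal)}

/-- `κ̄_δ(θ;γ,P)`: primal upper value (explicit-dependence case); `= ⊥` if infeasible. -/
def kappaHigh (δ : ℝ) (θ : Fin dθ → ℝ) (γ : Γ) (P : Vec12 d1 d2) : EReal :=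
  sSup {x : EReal | ∃ F : Measure U, Feasible φ Fstar g δ θ γ P F ∧
    Integrable (fun u => k u θ γ) F ∧ x = ((∫ u, k u θ γ ∂F : ℝ) : EReal)}

/-- `κ̲*_δ(θ;γ,P)`: the dual program of `κ̲_δ`.  Multipliers with
`E^{F*}[(ηφ)*(...)] = +∞` contribute `-∞` to the supremum and are omitted from the
index set; `w` is a real-valued integrable version of the conjugate integrand. -/
def kappaLowDual (δ : ℝ) (θ : Fin dθ → ℝ) (γ : Γ) (P : Vec12 d1 d2) : EReal :=
  sSup {x : EReal | ∃ η : ℝ, 0 ≤ η ∧ ∃ ζ : ℝ, ∃ l : Vec4 d1 d2 d3 d4, inLambda l ∧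
    ∃ w : U → ℝ, Integrable w Fstar ∧
      (∀ᵐ u ∂Fstar, (w u : EReal) = etaPhiStar φ η (-(k u θ γ) - ζ - dot4 l (g u θ γ))) ∧
      x = ((-(∫ u, w u ∂Fstar) - η * δ - ζ - dotP l P : ℝ) : EReal)}

/-- `κ̄*_δ(θ;γ,P)`: the dual program of `κ̄_δ`. -/
def kappaHighDual (δ : ℝ) (θ : Fin dθ → ℝ) (γ : Γ) (P : Vec12 d1 d2) : EReal :=
  sInf {x : EReal | ∃ η : ℝ, 0 ≤ η ∧ ∃ ζ : ℝ, ∃ l : Vec4 d1 d2 d3 d4, inLambda l ∧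
    ∃ w : U → ℝ, Integrable w Fstar ∧
      (∀ᵐ u ∂Fstar, (w u : EReal) = etaPhiStar φ η (k u θ γ - ζ - dot4 l (g u θ γ))) ∧
      x = (((∫ u, w u ∂Fstar) + η * δ + ζ + dotP l P : ℝ) : EReal)}

/-- `δ*(θ;γ,P) = sup_{ζ,λ∈Λ} ( -E^{F*}[φ*(-ζ-λ'g)] - ζ - λ12'P )`. -/
def deltaStar (θ : Fin dθ → ℝ) (γ : Γ) (P : Vec12 d1 d2) : EReal :=
  sSup {x : EReal | ∃ ζ : ℝ, ∃ l : Vec4 d1 d2 d3 d4, inLambda l ∧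
    ∃ w : U → ℝ, Integrable w Fstar ∧
      (∀ᵐ u ∂Fstar, (w u : EReal) = phiStar φ (-ζ - dot4 l (g u θ γ))) ∧
      x = ((-(∫ u, w u ∂Fstar) - ζ - dotP l P : ℝ) : EReal)}

/-- `{E^F[g(U,θ,γ)] : F ∈ N_∞}`. -/
def momentSet (θ : Fin dθ → ℝ) (γ : Γ) : Set (Vec4 d1 d2 d3 d4) :=
  {v | ∃ F : Measure U, IsProbabilityMeasure F ∧ Dphi φ Fstar F < ⊤ ∧ GIntegrable g θ γ F ∧
    v = ((fun i => ∫ u, (g u θ γ).1 i ∂F), (fun i => ∫ u, (g u θ γ).2.1 i ∂F),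
         (fun i => ∫ u, (g u θ γ).2.2.1 i ∂F), (fun i => ∫ u, (g u θ γ).2.2.2 i ∂F))}

/-- The cone `𝒞 = ℝ^{d1}_{≥0} × {0} × ℝ^{d3}_{≥0} × {0}`. -/
def coneC : Set (Vec4 d1 d2 d3 d4) :=
  {c | (∀ i, 0 ≤ c.1 i) ∧ c.2.1 = 0 ∧ (∀ i, 0 ≤ c.2.2.1 i) ∧ c.2.2.2 = 0}

/-- Condition S at `(θ,γ,P)`. -/
def ConditionS (θ : Fin dθ → ℝ) (γ : Γ) (P : Vec12 d1 d2) : Prop :=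
  ((P.1, P.2, (0 : Fin d3 → ℝ), (0 : Fin d4 → ℝ)) : Vec4 d1 d2 d3 d4) ∈
    interior (momentSet φ Fstar g θ γ + coneC)

/-- Assumption Φ(ii): `k(·,θ,γ)` and each component of `g(·,θ,γ)` lie in `ℰ`. -/
def PhiTwo : Prop :=
  ∀ (θ : Fin dθ → ℝ) (γ : Γ), MemE φ Fstar (fun u => k u θ γ) ∧
    (∀ i, MemE φ Fstar (fun u => (g u θ γ).1 i)) ∧
    (∀ i, MemE φ Fstar (fun u => (g u θ γ).2.1 i)) ∧
    (∀ i, MemE φ Fstar (fun u => (g u θ γ).2.2.1 i)) ∧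
    (∀ i, MemE φ Fstar (fun u => (g u θ γ).2.2.2 i))

/-- `Θ_δ = {θ ∈ Θ : δ*(θ;γ0,P0) < δ}`. -/
def ThetaDelta (Θ : Set (Fin dθ → ℝ)) (γ0 : Γ) (P0 : Vec12 d1 d2) (δ : ℝ) :
    Set (Fin dθ → ℝ) :=
  {θ ∈ Θ | deltaStar φ Fstar g θ γ0 P0 < ((δ : ℝ) : EReal)}

/-- Implicit-dependence lower value: `kI(θ,γ)` if feasible, `+∞` otherwise. -/
def kappaLowImp (kI : (Fin dθ → ℝ) → Γ → ℝ) (δ : ℝ) (θ : Fin dθ → ℝ) (γ : Γ)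
    (P : Vec12 d1 d2) : EReal :=
  sInf {x : EReal | ∃ F : Measure U, Feasible φ Fstar g δ θ γ P F ∧ x = ((kI θ γ : ℝ) : EReal)}

/-- Implicit-dependence upper value: `kI(θ,γ)` if feasible, `-∞` otherwise. -/
def kappaHighImp (kI : (Fin dθ → ℝ) → Γ → ℝ) (δ : ℝ) (θ : Fin dθ → ℝ) (γ : Γ)
    (P : Vec12 d1 d2) : EReal :=
  sSup {x : EReal | ∃ F : Measure U, Feasible φ Fstar g δ θ γ P F ∧ x = ((kI θ γ : ℝ) : EReal)}

/-- The criterion `K̲_δ(θ;γ,P)`. -/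
def KLowCrit (δ : ℝ) (θ : Fin dθ → ℝ) (γ : Γ) (P : Vec12 d1 d2) : EReal :=
  if deltaStar φ Fstar g θ γ P < ((δ : ℝ) : EReal) then kappaLowDual φ Fstar g k δ θ γ P
  else if deltaStar φ Fstar g θ γ P = ((δ : ℝ) : EReal) then kappaLow φ Fstar g k δ θ γ P
  else ⊤

/-- The criterion `K̄_δ(θ;γ,P)`. -/
def KHighCrit (δ : ℝ) (θ : Fin dθ → ℝ) (γ : Γ) (P : Vec12 d1 d2) : EReal :=
  if deltaStar φ Fstar g θ γ P < ((δ : ℝ) : EReal) then kappaHighDual φ Fstar g k δ θ γ P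
  else if deltaStar φ Fstar g θ γ P = ((δ : ℝ) : EReal) then kappaHigh φ Fstar g k δ θ γ P
  else ⊥

/-- ℰ-continuity of a family `f(·,θ,γ)` in `(θ,γ)` on `Θ × Γ`. -/
def EContinuousIn [TopologicalSpace Γ] (Θ : Set (Fin dθ → ℝ))
    (f : U → (Fin dθ → ℝ) → Γ → ℝ) : Prop :=
  ∀ θ0 ∈ Θ, ∀ γ0 : Γ,
    Tendsto (fun p : (Fin dθ → ℝ) × Γ => psiNorm φ Fstar (fun u => f u p.1 p.2 - f u θ0 γ0))
      (nhdsWithin (θ0, γ0) (Θ ×ˢ (Set.univ : Set Γ))) (nhds 0)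

/-- Assumption M(i) for the moment functions. -/
def MOneG [TopologicalSpace Γ] (Θ : Set (Fin dθ → ℝ)) : Prop :=
  (∀ i, EContinuousIn φ Fstar Θ (fun u θ γ => (g u θ γ).1 i)) ∧
  (∀ i, EContinuousIn φ Fstar Θ (fun u θ γ => (g u θ γ).2.1 i)) ∧
  (∀ i, EContinuousIn φ Fstar Θ (fun u θ γ => (g u θ γ).2.2.1 i)) ∧
  (∀ i, EContinuousIn φ Fstar Θ (fun u θ γ => (g u θ γ).2.2.2 i))

/-- Assumption M(v). -/
def MFive [TopologicalSpace Γ] (Θ : Set (Fin dθ → ℝ)) : Prop :=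
  ∀ (c1 c2 : ℝ) (c3 : Vec4 d1 d2 d3 d4), ContinuousOn
    (fun p : (Fin dθ → ℝ) × Γ =>
      eExp Fstar (φ 0) (fun u => phiStar φ (c1 + c2 * k u p.1 p.2 + dot4 c3 (g u p.1 p.2))))
    (Θ ×ˢ (Set.univ : Set Γ))

/-- Objective of the dual program for the lower value, as a function of `(η,ζ,λ)`. -/
def lowObj (δ : ℝ) (θ : Fin dθ → ℝ) (γ : Γ) (P : Vec12 d1 d2) (η ζ : ℝ)
    (l : Vec4 d1 d2 d3 d4) : EReal :=
  -(eExp Fstar (η * φ 0) (fun u => etaPhiStar φ η (-(k u θ γ) - ζ - dot4 l (g u θ γ))))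
    - ((η * δ : ℝ) : EReal) - ((ζ : ℝ) : EReal) - ((dotP l P : ℝ) : EReal)

/-- Objective of the dual program for the upper value. -/
def highObj (δ : ℝ) (θ : Fin dθ → ℝ) (γ : Γ) (P : Vec12 d1 d2) (η ζ : ℝ)
    (l : Vec4 d1 d2 d3 d4) : EReal :=
  (eExp Fstar (η * φ 0) (fun u => etaPhiStar φ η (k u θ γ - ζ - dot4 l (g u θ γ))))
    + ((η * δ : ℝ) : EReal) + ((ζ : ℝ) : EReal) + ((dotP l P : ℝ) : EReal)

/-- `Ξ̲_δ(θ)`: maximizers of the lower dual program. -/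
def XiLow (δ : ℝ) (θ : Fin dθ → ℝ) (γ : Γ) (P : Vec12 d1 d2) :
    Set (ℝ × ℝ × Vec4 d1 d2 d3 d4) :=
  {ξ | 0 ≤ ξ.1 ∧ inLambda ξ.2.2 ∧ ∀ ξ' : ℝ × ℝ × Vec4 d1 d2 d3 d4, 0 ≤ ξ'.1 → inLambda ξ'.2.2 →
    lowObj φ Fstar g k δ θ γ P ξ'.1 ξ'.2.1 ξ'.2.2 ≤ lowObj φ Fstar g k δ θ γ P ξ.1 ξ.2.1 ξ.2.2}

/-- `Ξ̄_δ(θ)`: minimizers of the upper dual program. -/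
def XiHigh (δ : ℝ) (θ : Fin dθ → ℝ) (γ : Γ) (P : Vec12 d1 d2) :
    Set (ℝ × ℝ × Vec4 d1 d2 d3 d4) :=
  {ξ | 0 ≤ ξ.1 ∧ inLambda ξ.2.2 ∧ ∀ ξ' : ℝ × ℝ × Vec4 d1 d2 d3 d4, 0 ≤ ξ'.1 → inLambda ξ'.2.2 →
    highObj φ Fstar g k δ θ γ P ξ.1 ξ.2.1 ξ.2.2 ≤ highObj φ Fstar g k δ θ γ P ξ'.1 ξ'.2.1 ξ'.2.2}

/-- `Λ̲_δ(θ)`: `(λ1,λ2)`-projections of `Ξ̲_δ(θ)`. -/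
def LamLow (δ : ℝ) (θ : Fin dθ → ℝ) (γ : Γ) (P : Vec12 d1 d2) : Set (Vec12 d1 d2) :=
  {p | ∃ ξ ∈ XiLow φ Fstar g k δ θ γ P, ξ.2.2.1 = p.1 ∧ ξ.2.2.2.1 = p.2}

/-- `Λ̄_δ(θ)`: `(λ1,λ2)`-projections of `Ξ̄_δ(θ)`. -/
def LamHigh (δ : ℝ) (θ : Fin dθ → ℝ) (γ : Γ) (P : Vec12 d1 d2) : Set (Vec12 d1 d2) :=
  {p | ∃ ξ ∈ XiHigh φ Fstar g k δ θ γ P, ξ.2.2.1 = p.1 ∧ ξ.2.2.2.1 = p.2}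

end Model

end CFSens

namespace CFSens

variable {U : Type*} [MeasurableSpace U] {dθ d1 d2 d3 d4 : ℕ} {Γ : Type*}

/-- The identified set of counterfactuals `K_#` (implicit-dependence case):
values `kI(θ,γ0)` over `θ ∈ Θ` such that some `F ∈ F_θ` satisfies the model constraints. -/
def KSharpImp (μmeas : Measure U) (g : U → (Fin dθ → ℝ) → Γ → Vec4 d1 d2 d3 d4)
    (kI : (Fin dθ → ℝ) → Γ → ℝ) (Θ : Set (Fin dθ → ℝ)) (γ0 : Γ)
    (P0 : Vec12 d1 d2) : Set ℝ :=
  {x | ∃ θ ∈ Θ, ∃ F : Measure U, IsProbabilityMeasure F ∧ F ≪ μmeas ∧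
    ConstraintsHold g θ γ0 P0 F ∧ x = kI θ γ0}

end CFSens

open CFSens

namespace CFSens

section

variable {U : Type*} [MeasurableSpace U] {dθ d1 d2 d3 d4 : ℕ} {Γ : Type*}
  {φ : ℝ → ℝ} {Fstar : Measure U} {g : U → (Fin dθ → ℝ) → Γ → Vec4 d1 d2 d3 d4}
  {θ : Fin dθ → ℝ} {γ : Γ} {P : Vec12 d1 d2} {F : Measure U} {δ δ' : ℝ}

/-- A measure of finite divergence is absolutely continuous. -/
theorem absolutelyContinuous_of_Dphi_lt_top (h : Dphi φ Fstar F < ⊤) : F ≪ Fstar := by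
  by_contra hF
  simp [Dphi, hF] at h

theorem Feasible.absolutelyContinuous (h : Feasible φ Fstar g δ θ γ P F) : F ≪ Fstar :=
  absolutelyContinuous_of_Dphi_lt_top (h.2.1.trans_lt ENNReal.ofReal_lt_top)

theorem Feasible.mono (hδ : δ ≤ δ') (h : Feasible φ Fstar g δ θ γ P F) :
    Feasible φ Fstar g δ' θ γ P F :=
  ⟨h.1, h.2.1.trans (ENNReal.ofReal_le_ofReal hδ), h.2.2⟩

/-- Condition S yields a feasible distribution in a large enough neighborhood. -/
theorem ConditionS.exists_feasible (h : ConditionS φ Fstar g θ γ P) :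
    ∃ δ F, Feasible φ Fstar g δ θ γ P F := by
  obtain ⟨v, ⟨F, hF, hD, hg, rfl⟩, c, ⟨hc1, hc2, hc3, hc4⟩, hsum⟩ :=
    Set.mem_add.1 (interior_subset h)
  simp only [Prod.ext_iff, Prod.fst_add, Prod.snd_add, funext_iff, Pi.add_apply,
    Pi.zero_apply] at hsum
  obtain ⟨h1, h2, h3, h4⟩ := hsum
  refine ⟨(Dphi φ Fstar F).toReal, F, hF, (ENNReal.ofReal_toReal hD.ne).ge, hg,
    fun i => ?_, fun i => ?_, fun i => ?_, fun i => ?_⟩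
  · linarith [h1 i, hc1 i]
  · simpa [hc2] using h2 i
  · linarith [h3 i, hc3 i]
  · simpa [hc4] using h4 i

theorem antitone_iInf_kappaLowImp (kI : (Fin dθ → ℝ) → Γ → ℝ) (Θ : Set (Fin dθ → ℝ)) :
    Antitone fun δ : ℝ => ⨅ θ ∈ Θ, kappaLowImp φ Fstar g kI δ θ γ P :=
  fun _ _ hδ => iInf₂_mono fun _ _ => sInf_le_sInf fun _ ⟨F, hF, hx⟩ => ⟨F, hF.mono hδ, hx⟩

theorem monotone_iSup_kappaHighImp (kI : (Fin dθ → ℝ) → Γ → ℝ) (Θ : Set (Fin dθ → ℝ)) :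
    Monotone fun δ : ℝ => ⨆ θ ∈ Θ, kappaHighImp φ Fstar g kI δ θ γ P :=
  fun _ _ hδ => iSup₂_mono fun _ _ => sSup_le_sSup fun _ ⟨F, hF, hx⟩ => ⟨F, hF.mono hδ, hx⟩

end

end CFSens

/-- **Theorem 4: sharpness of the bounds, implicit-dependence case.**
Under Assumptions Φ(i) and Φ(ii), if Condition S holds at `(θ,γ0,P0)` for every `θ ∈ Θ`
and `μ` and `F*` are mutually absolutely continuous, then `κ̲(N_δ) → inf K_#` and
`κ̄(N_δ) → sup K_#` as `δ → ∞`. -/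
theorem sharp_bounds_implicit
    {U : Type*} [MeasurableSpace U] {dθ d1 d2 d3 d4 : ℕ} {Γ : Type*}
    (φ : ℝ → ℝ) (Fstar : Measure U) [IsProbabilityMeasure Fstar]
    (μmeas : Measure U) [SigmaFinite μmeas]
    (g : U → (Fin dθ → ℝ) → Γ → Vec4 d1 d2 d3 d4)
    (kI : (Fin dθ → ℝ) → Γ → ℝ)
    (Θ : Set (Fin dθ → ℝ)) (γ0 : Γ) (P0 : Vec12 d1 d2)
    (hΦ1 : PhiOne φ)
    (hΦ2g : ∀ (θ : Fin dθ → ℝ) (γ : Γ),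
      (∀ i, MemE φ Fstar (fun u => (g u θ γ).1 i)) ∧
      (∀ i, MemE φ Fstar (fun u => (g u θ γ).2.1 i)) ∧
      (∀ i, MemE φ Fstar (fun u => (g u θ γ).2.2.1 i)) ∧
      (∀ i, MemE φ Fstar (fun u => (g u θ γ).2.2.2 i)))
    (hS : ∀ θ ∈ Θ, ConditionS φ Fstar g θ γ0 P0)
    (hac1 : μmeas ≪ Fstar) (hac2 : Fstar ≪ μmeas) :
    Tendsto (fun δ : ℝ => ⨅ θ ∈ Θ, kappaLowImp φ Fstar g kI δ θ γ0 P0) atTop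
      (nhds (sInf ((fun x : ℝ => (x : EReal)) '' KSharpImp μmeas g kI Θ γ0 P0))) ∧
    Tendsto (fun δ : ℝ => ⨆ θ ∈ Θ, kappaHighImp φ Fstar g kI δ θ γ0 P0) atTop
      (nhds (sSup ((fun x : ℝ => (x : EReal)) '' KSharpImp μmeas g kI Θ γ0 P0))) := by
  constructor
  · convert tendsto_atTop_iInf (antitone_iInf_kappaLowImp kI Θ) using 2
    apply le_antisymm
    · refine le_iInf fun δ => le_iInf₂ fun θ hθ => le_sInf ?_
      rintro _ ⟨F, hF, rfl⟩
      exact sInf_le ⟨_, ⟨θ, hθ, F, hF.1, hF.absolutelyContinuous.trans hac2, hF.2.2, rfl⟩, rfl⟩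
    · refine le_sInf ?_
      rintro _ ⟨_, ⟨θ, hθ, -, -, -, -, rfl⟩, rfl⟩
      obtain ⟨δ, F, hF⟩ := (hS θ hθ).exists_feasible
      exact iInf_le_of_le δ (iInf₂_le_of_le θ hθ (sInf_le ⟨F, hF, rfl⟩))
  · convert tendsto_atTop_iSup (monotone_iSup_kappaHighImp kI Θ) using 2
    apply le_antisymm
    · refine sSup_le ?_
      rintro _ ⟨_, ⟨θ, hθ, -, -, -, -, rfl⟩, rfl⟩
      obtain ⟨δ, F, hF⟩ := (hS θ hθ).exists_feasible
      exact le_iSup_of_le δ (le_iSup₂_of_le θ hθ (le_sSup ⟨F, hF, rfl⟩))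
    · refine iSup_le fun δ => iSup₂_le fun θ hθ => sSup_le ?_
      rintro _ ⟨F, hF, rfl⟩
      exact le_sSup ⟨_, ⟨θ, hθ, F, hF.1, hF.absolutelyContinuous.trans hac2, hF.2.2, rfl⟩, rfl⟩
end
end

section
/- Local sensitivity equals twice the second moment of the influence function, explicit-dependence case (Theorem 5): under χ²-divergence, Assumptions Φ(ii), M(i) and M(iv), and the GMM-type regularity conditions listed, the local sensitivity limit s = lim_{δ↓0} (κ̄(N_δ) − κ̲(N_δ))²/(4δ) exists and equals 2 E^{F*}[ι(U)²], where ι(u) = Πk₀(u) − J(H'V⁻¹H)⁻¹H'V⁻¹h₀(u). -/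
open MeasureTheory Filter Set
open scoped ENNReal Pointwise Classical

noncomputable section

namespace CFSens

section ChiSq

variable {U : Type*} [MeasurableSpace U] {dθ d2 d4 : ℕ}

/-- χ²-divergence cost `φ(x) = (x-1)²/2`. -/
def chiSq : ℝ → ℝ := fun x => (x - 1) ^ 2 / 2

/-- The moment functions `(g2 - ·, g4)` embedded in the general framework with
`d1 = d3 = 0` and vacuous auxiliary parameter. -/
def gChi (g2 : U → (Fin dθ → ℝ) → Fin d2 → ℝ) (g4 : U → (Fin dθ → ℝ) → Fin d4 → ℝ) :
    U → (Fin dθ → ℝ) → Unit → Vec4 0 d2 0 d4 :=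
  fun u θ _ => ((fun i => i.elim0), g2 u θ, (fun i => i.elim0), g4 u θ)

/-- counterfactual function embedded in the general framework. -/
def kChi (k : U → (Fin dθ → ℝ) → ℝ) : U → (Fin dθ → ℝ) → Unit → ℝ := fun u θ _ => k u θ

/-- targeted moments `(·, P20)` with `d1 = 0`. -/
def PChi (P20 : Fin d2 → ℝ) : Vec12 0 d2 := ((fun i => i.elim0), P20)

/-- stacked moment function `h(u,θ) = (g2(u,θ) - P20, g4(u,θ))`. -/
def hFun (g2 : U → (Fin dθ → ℝ) → Fin d2 → ℝ) (g4 : U → (Fin dθ → ℝ) → Fin d4 → ℝ)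
    (P20 : Fin d2 → ℝ) : U → (Fin dθ → ℝ) → (Fin d2 ⊕ Fin d4) → ℝ :=
  fun u θ => Sum.elim (fun i => g2 u θ i - P20 i) (fun j => g4 u θ j)

/-- `κ̲(N_δ)` for the χ² model with equality restrictions only. -/
def chiLowValue (Fstar : Measure U) (g2 : U → (Fin dθ → ℝ) → Fin d2 → ℝ)
    (g4 : U → (Fin dθ → ℝ) → Fin d4 → ℝ) (k : U → (Fin dθ → ℝ) → ℝ)
    (Θ : Set (Fin dθ → ℝ)) (P20 : Fin d2 → ℝ) (δ : ℝ) : EReal :=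
  ⨅ θ ∈ Θ, kappaLow chiSq Fstar (gChi g2 g4) (kChi k) δ θ () (PChi P20)

/-- `κ̄(N_δ)` for the χ² model with equality restrictions only. -/
def chiHighValue (Fstar : Measure U) (g2 : U → (Fin dθ → ℝ) → Fin d2 → ℝ)
    (g4 : U → (Fin dθ → ℝ) → Fin d4 → ℝ) (k : U → (Fin dθ → ℝ) → ℝ)
    (Θ : Set (Fin dθ → ℝ)) (P20 : Fin d2 → ℝ) (δ : ℝ) : EReal :=
  ⨆ θ ∈ Θ, kappaHigh chiSq Fstar (gChi g2 g4) (kChi k) δ θ () (PChi P20)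

/-- `κ̲(N_δ)` for the χ² model, implicit-dependence case. -/
def chiLowValueImp (Fstar : Measure U) (g2 : U → (Fin dθ → ℝ) → Fin d2 → ℝ)
    (g4 : U → (Fin dθ → ℝ) → Fin d4 → ℝ) (k : (Fin dθ → ℝ) → ℝ)
    (Θ : Set (Fin dθ → ℝ)) (P20 : Fin d2 → ℝ) (δ : ℝ) : EReal :=
  ⨅ θ ∈ Θ, kappaLowImp chiSq Fstar (gChi g2 g4) (fun θ' _ => k θ') δ θ () (PChi P20)

/-- `κ̄(N_δ)` for the χ² model, implicit-dependence case. -/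
def chiHighValueImp (Fstar : Measure U) (g2 : U → (Fin dθ → ℝ) → Fin d2 → ℝ)
    (g4 : U → (Fin dθ → ℝ) → Fin d4 → ℝ) (k : (Fin dθ → ℝ) → ℝ)
    (Θ : Set (Fin dθ → ℝ)) (P20 : Fin d2 → ℝ) (δ : ℝ) : EReal :=
  ⨆ θ ∈ Θ, kappaHighImp chiSq Fstar (gChi g2 g4) (fun θ' _ => k θ') δ θ () (PChi P20)

/-- The influence function
`ι(u) = Πk₀(u) - J (H'V⁻¹H)⁻¹ H'V⁻¹ h₀(u)` (explicit-dependence case). -/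
def influence (Fstar : Measure U) (k : U → (Fin dθ → ℝ) → ℝ)
    (h : U → (Fin dθ → ℝ) → (Fin d2 ⊕ Fin d4) → ℝ) (θstar : Fin dθ → ℝ)
    (H : Matrix (Fin d2 ⊕ Fin d4) (Fin dθ) ℝ)
    (V : Matrix (Fin d2 ⊕ Fin d4) (Fin d2 ⊕ Fin d4) ℝ)
    (J : Fin dθ → ℝ) (u : U) : ℝ :=
  (k u θstar - ∫ v, k v θstar ∂Fstar)
  - dot (fun s => ∫ v, k v θstar * h v θstar s ∂Fstar)
      ((V⁻¹ - V⁻¹ * H * (H.transpose * V⁻¹ * H)⁻¹ * H.transpose * V⁻¹).mulVec (h u θstar))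
  - dot J (((H.transpose * V⁻¹ * H)⁻¹ * H.transpose * V⁻¹).mulVec (h u θstar))

/-- The influence function `ι(u) = -J (H'V⁻¹H)⁻¹ H'V⁻¹ h₀(u)` (implicit-dependence case). -/
def influenceImp (h : U → (Fin dθ → ℝ) → (Fin d2 ⊕ Fin d4) → ℝ) (θstar : Fin dθ → ℝ)
    (H : Matrix (Fin d2 ⊕ Fin d4) (Fin dθ) ℝ)
    (V : Matrix (Fin d2 ⊕ Fin d4) (Fin d2 ⊕ Fin d4) ℝ)
    (J : Fin dθ → ℝ) (u : U) : ℝ :=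
  -(dot J (((H.transpose * V⁻¹ * H)⁻¹ * H.transpose * V⁻¹).mulVec (h u θstar)))

end ChiSq

end CFSens

open CFSens

namespace CFSens

section SquareIntegrable

variable {U : Type*} [MeasurableSpace U] {μ : Measure U}

theorem inner_toLp_eq_integral {f g : U → ℝ} (hf : MemLp f 2 μ) (hg : MemLp g 2 μ) :
    inner ℝ (hf.toLp f) (hg.toLp g) = ∫ u, f u * g u ∂μ := by
  rw [L2.inner_def]
  refine integral_congr_ae ?_
  filter_upwards [hf.coeFn_toLp, hg.coeFn_toLp] with u h1 h2
  rw [h1, h2]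
  simp [mul_comm]

theorem norm_toLp_sq {f : U → ℝ} (hf : MemLp f 2 μ) :
    ‖hf.toLp f‖ ^ 2 = ∫ u, f u ^ 2 ∂μ := by
  rw [← real_inner_self_eq_norm_sq, inner_toLp_eq_integral]
  simp [sq]

/-- Cauchy–Schwarz inequality for square-integrable functions. -/
theorem abs_integral_mul_le_sqrt {f g : U → ℝ} (hf : MemLp f 2 μ) (hg : MemLp g 2 μ) :
    |∫ u, f u * g u ∂μ| ≤ √(∫ u, f u ^ 2 ∂μ) * √(∫ u, g u ^ 2 ∂μ) := by
  rw [← inner_toLp_eq_integral hf hg, ← norm_toLp_sq hf, ← norm_toLp_sq hg,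
    Real.sqrt_sq (norm_nonneg _), Real.sqrt_sq (norm_nonneg _)]
  exact abs_real_inner_le_norm _ _

theorem tendsto_toLp {ι : Type*} {l : Filter ι} {f : ι → U → ℝ} {f0 : U → ℝ}
    (hf : ∀ i, MemLp (f i) 2 μ) (hf0 : MemLp f0 2 μ)
    (h : Tendsto (fun i => ∫ u, (f i u - f0 u) ^ 2 ∂μ) l (nhds 0)) :
    Tendsto (fun i => (hf i).toLp (f i)) l (nhds (hf0.toLp f0)) := by
  rw [tendsto_iff_norm_sub_tendsto_zero]
  have h2 := h.sqrt
  rw [Real.sqrt_zero] at h2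
  refine h2.congr fun i => ?_
  rw [← MemLp.toLp_sub]
  have := norm_toLp_sq ((hf i).sub hf0)
  simp only [Pi.sub_apply] at this
  rw [← this, Real.sqrt_sq (norm_nonneg _)]

/-- The integral of a product is continuous for `L²`-convergence of both factors. -/
theorem tendsto_integral_mul {ι : Type*} {l : Filter ι} {f g : ι → U → ℝ} {f0 g0 : U → ℝ}
    (hf : ∀ i, MemLp (f i) 2 μ) (hf0 : MemLp f0 2 μ)
    (hg : ∀ i, MemLp (g i) 2 μ) (hg0 : MemLp g0 2 μ)
    (hff : Tendsto (fun i => ∫ u, (f i u - f0 u) ^ 2 ∂μ) l (nhds 0))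
    (hgg : Tendsto (fun i => ∫ u, (g i u - g0 u) ^ 2 ∂μ) l (nhds 0)) :
    Tendsto (fun i => ∫ u, f i u * g i u ∂μ) l (nhds (∫ u, f0 u * g0 u ∂μ)) := by
  have := (tendsto_toLp hf hf0 hff).inner (𝕜 := ℝ) (tendsto_toLp hg hg0 hgg)
  simpa only [inner_toLp_eq_integral] using this

theorem tendsto_integral_const_mul {ι : Type*} {l : Filter ι} {g : ι → U → ℝ} {f g0 : U → ℝ}
    (hf : MemLp f 2 μ) (hg : ∀ i, MemLp (g i) 2 μ) (hg0 : MemLp g0 2 μ)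
    (hgg : Tendsto (fun i => ∫ u, (g i u - g0 u) ^ 2 ∂μ) l (nhds 0)) :
    Tendsto (fun i => ∫ u, f u * g i u ∂μ) l (nhds (∫ u, f u * g0 u ∂μ)) :=
  tendsto_integral_mul (fun _ => hf) hf hg hg0 (by simpa using tendsto_const_nhds) hgg

theorem integral_lincomb_mul {S : Type*} [Fintype S] {b : U → ℝ} {B : S → U → ℝ} {g : U → ℝ}
    (c : S → ℝ) (hb : MemLp b 2 μ) (hB : ∀ s, MemLp (B s) 2 μ) (hg : MemLp g 2 μ) :
    ∫ u, (b u + ∑ s, c s * B s u) * g u ∂μ =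
      ∫ u, b u * g u ∂μ + ∑ s, c s * ∫ u, B s u * g u ∂μ := by
  have h1 : Integrable (fun u => b u * g u) μ := hb.integrable_mul hg
  have h2 : ∀ s, Integrable (fun u => c s * (B s u * g u)) μ :=
    fun s => ((hB s).integrable_mul hg).const_mul _
  have : ∀ u, (b u + ∑ s, c s * B s u) * g u = b u * g u + ∑ s, c s * (B s u * g u) := by
    intro u
    rw [add_mul, Finset.sum_mul]
    simp only [mul_assoc]
  simp_rw [this]
  rw [integral_add h1 (integrable_finsetSum _ fun s _ => h2 s),
    integral_finsetSum _ fun s _ => h2 s]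
  simp_rw [integral_const_mul]

theorem memLp_lincomb {S : Type*} [Fintype S] {b : U → ℝ} {B : S → U → ℝ}
    (c : S → ℝ) (hb : MemLp b 2 μ) (hB : ∀ s, MemLp (B s) 2 μ) :
    MemLp (fun u => b u + ∑ s, c s * B s u) 2 μ :=
  hb.add (memLp_finsetSum _ fun s _ => (hB s).const_mul (c s))

theorem memLp_two_of_abs_le [IsFiniteMeasure μ] {f : U → ℝ} (hf : Measurable f) {K : ℝ}
    (h : ∀ u, |f u| ≤ K) : MemLp f 2 μ :=
  MemLp.of_bound hf.aestronglyMeasurable K (ae_of_all _ h)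

/-- Truncation of `f` at level `n`, recentred to have mean zero. -/
def centeredTrunc (μ : Measure U) (f : U → ℝ) (n : ℕ) (u : U) : ℝ :=
  max (-n : ℝ) (min n (f u)) - ∫ v, max (-n : ℝ) (min n (f v)) ∂μ

theorem abs_trunc_le (x : ℝ) (n : ℕ) : |max (-n : ℝ) (min n x)| ≤ n := by
  have : (0 : ℝ) ≤ n := n.cast_nonneg
  rw [abs_le]
  exact ⟨le_max_left _ _, max_le (by linarith) (min_le_left _ _)⟩

theorem abs_trunc_sub_le (x : ℝ) (n : ℕ) : |max (-n : ℝ) (min n x) - x| ≤ |x| := by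
  have : (0 : ℝ) ≤ n := n.cast_nonneg
  rcases max_cases (-n : ℝ) (min n x) with h | h <;> rcases min_cases (n : ℝ) x with h' | h' <;>
    rcases abs_cases x with hx | hx <;> rw [abs_le] <;> constructor <;> linarith

theorem measurable_trunc {f : U → ℝ} (hf : Measurable f) (n : ℕ) :
    Measurable (fun u => max (-n : ℝ) (min n (f u))) :=
  measurable_const.max (measurable_const.min hf)

theorem measurable_centeredTrunc {f : U → ℝ} (hf : Measurable f) (n : ℕ) :
    Measurable (centeredTrunc μ f n) :=
  (measurable_trunc hf n).sub_const _

theorem abs_centeredTrunc_le [IsProbabilityMeasure μ] (f : U → ℝ) (n : ℕ) (u : U) :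
    |centeredTrunc μ f n u| ≤ 2 * n := by
  have h1 := abs_trunc_le (f u) n
  have h2 : |∫ v, max (-n : ℝ) (min n (f v)) ∂μ| ≤ n := by
    have := norm_integral_le_of_norm_le_const (μ := μ)
      (f := fun v => max (-n : ℝ) (min n (f v))) (ae_of_all _ fun v => abs_trunc_le (f v) n)
    simpa using this
  have := abs_sub (max (-n : ℝ) (min n (f u))) (∫ v, max (-n : ℝ) (min n (f v)) ∂μ)
  unfold centeredTrunc
  linarith

theorem memLp_trunc [IsProbabilityMeasure μ] {f : U → ℝ} (hf : Measurable f) (n : ℕ) :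
    MemLp (fun u => max (-n : ℝ) (min n (f u))) 2 μ :=
  memLp_two_of_abs_le (measurable_trunc hf n) fun u => abs_trunc_le (f u) n

theorem integral_centeredTrunc [IsProbabilityMeasure μ] {f : U → ℝ} (hf : Measurable f) (n : ℕ) :
    ∫ u, centeredTrunc μ f n u ∂μ = 0 := by
  unfold centeredTrunc
  rw [integral_sub ((memLp_trunc hf n).integrable one_le_two) (integrable_const _)]
  simp

theorem integral_sub_mean_sq_le [IsProbabilityMeasure μ] {f : U → ℝ} (hf : MemLp f 2 μ) :
    ∫ u, (f u - ∫ v, f v ∂μ) ^ 2 ∂μ ≤ ∫ u, f u ^ 2 ∂μ := by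
  set a := ∫ v, f v ∂μ with ha
  have h1 : ∀ u, (f u - a) ^ 2 = f u ^ 2 - 2 * a * f u + a ^ 2 := fun u => by ring
  simp_rw [h1]
  have hi := hf.integrable one_le_two
  have h2 : Integrable (fun u => f u ^ 2 - 2 * a * f u) μ :=
    hf.integrable_sq.sub (hi.const_mul _)
  rw [integral_add h2 (integrable_const _),
    integral_sub hf.integrable_sq (hi.const_mul _), integral_const_mul, ← ha]
  simp
  nlinarith [sq_nonneg a]

theorem tendsto_centeredTrunc [IsProbabilityMeasure μ] {f : U → ℝ} (hf : Measurable f)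
    (hf2 : MemLp f 2 μ) (hf0 : ∫ u, f u ∂μ = 0) :
    Tendsto (fun n => ∫ u, (centeredTrunc μ f n u - f u) ^ 2 ∂μ) atTop (nhds 0) := by
  have h0 : Tendsto (fun n : ℕ => ∫ u, (max (-n : ℝ) (min n (f u)) - f u) ^ 2 ∂μ) atTop
      (nhds 0) := by
    have := tendsto_integral_of_dominated_convergence (μ := μ)
      (F := fun (n : ℕ) u => (max (-n : ℝ) (min n (f u)) - f u) ^ 2) (f := fun _ => 0)
      (fun u => f u ^ 2)
      (fun n => (((measurable_trunc hf n).sub hf).pow_const 2).aestronglyMeasurable)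
      hf2.integrable_sq
      (fun n => ae_of_all _ fun u => by
        rw [Real.norm_eq_abs, abs_pow, ← sq_abs (f u)]
        exact pow_le_pow_left₀ (abs_nonneg _) (abs_trunc_sub_le _ _) 2)
      (ae_of_all _ fun u => by
        refine tendsto_const_nhds.congr' ?_
        obtain ⟨N, hN⟩ := exists_nat_ge |f u|
        filter_upwards [eventually_ge_atTop N] with n hn
        have hn' : |f u| ≤ n := hN.trans (by exact_mod_cast hn)
        rw [abs_le] at hn'
        rw [min_eq_right hn'.2, max_eq_right hn'.1]
        simp)
    simpa using this
  refine squeeze_zero (fun n => integral_nonneg fun u => sq_nonneg _) (fun n => ?_) h0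
  have hm := (memLp_trunc (μ := μ) hf n).sub hf2
  refine le_trans (le_of_eq ?_) (integral_sub_mean_sq_le hm)
  congr 1
  ext u
  simp only [centeredTrunc]
  rw [integral_sub ((memLp_trunc hf n).integrable one_le_two) (hf2.integrable one_le_two), hf0]
  ring

theorem memLp_centeredTrunc [IsProbabilityMeasure μ] {f : U → ℝ} (hf : Measurable f) (n : ℕ) :
    MemLp (centeredTrunc μ f n) 2 μ :=
  memLp_two_of_abs_le (measurable_centeredTrunc hf n) (abs_centeredTrunc_le f n)

end SquareIntegrable

theorem tendsto_matrix_inv {S ι : Type*} [Fintype S] [DecidableEq S] {l : Filter ι}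
    {A : ι → Matrix S S ℝ} {A0 : Matrix S S ℝ} (h : Tendsto A l (nhds A0)) (h0 : A0.det ≠ 0) :
    Tendsto (fun i => (A i)⁻¹) l (nhds A0⁻¹) := by
  simp only [Matrix.inv_def, Ring.inverse_eq_inv']
  exact (((continuous_id.matrix_det.tendsto A0).comp h).inv₀ h0).smul
    ((continuous_id.matrix_adjugate.tendsto A0).comp h)

theorem tendsto_matrix_mulVec {S ι : Type*} [Fintype S] {l : Filter ι}
    {A : ι → Matrix S S ℝ} {A0 : Matrix S S ℝ} {v : ι → S → ℝ} {v0 : S → ℝ}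
    (h : Tendsto A l (nhds A0)) (hv : Tendsto v l (nhds v0)) :
    Tendsto (fun i => (A i).mulVec (v i)) l (nhds (A0.mulVec v0)) :=
  ((continuous_fst.matrix_mulVec continuous_snd).tendsto (A0, v0)).comp (h.prodMk_nhds hv)

/-- Approximation of a mean-zero `f ∈ L²` by a bounded mean-zero `b` with the same moments against
`h`, together with bounded mean-zero functions `B s` whose moments against `h` form an invertible
matrix. -/
theorem exists_bounded_approx {U : Type*} [MeasurableSpace U] {μ : Measure U}
    [IsProbabilityMeasure μ] {S : Type*} [Fintype S] [DecidableEq S] {f : U → ℝ} {h : S → U → ℝ}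
    (hf : Measurable f) (hf2 : MemLp f 2 μ) (hf0 : ∫ u, f u ∂μ = 0)
    (hh : ∀ s, Measurable (h s)) (hh2 : ∀ s, MemLp (h s) 2 μ) (hh0 : ∀ s, ∫ u, h s u ∂μ = 0)
    (hV : (Matrix.of fun s t => ∫ u, h s u * h t u ∂μ).det ≠ 0) {ε : ℝ} (hε : 0 < ε) :
    ∃ (b : U → ℝ) (B : S → U → ℝ) (K : ℝ), Measurable b ∧ (∀ s, Measurable (B s)) ∧
      (∀ u, |b u| ≤ K) ∧ (∀ s u, |B s u| ≤ K) ∧ ∫ u, b u ∂μ = 0 ∧ (∀ s, ∫ u, B s u ∂μ = 0) ∧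
      (∀ s, ∫ u, b u * h s u ∂μ = ∫ u, f u * h s u ∂μ) ∧
      |∫ u, b u * f u ∂μ - ∫ u, f u ^ 2 ∂μ| < ε ∧ ∫ u, b u ^ 2 ∂μ < ∫ u, f u ^ 2 ∂μ + ε ∧
      (Matrix.of fun s t => ∫ u, B t u * h s u ∂μ).det ≠ 0 := by
  set V : Matrix S S ℝ := Matrix.of fun s t => ∫ u, h s u * h t u ∂μ with hVdef
  let Tf : ℕ → U → ℝ := fun n => centeredTrunc μ f n
  let T : ℕ → S → U → ℝ := fun n s => centeredTrunc μ (h s) n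
  have hTf : ∀ n, MemLp (Tf n) 2 μ := fun n => memLp_centeredTrunc hf n
  have hT : ∀ n s, MemLp (T n s) 2 μ := fun n s => memLp_centeredTrunc (hh s) n
  have lTf := tendsto_centeredTrunc hf hf2 hf0
  have lT := fun s => tendsto_centeredTrunc (hh s) (hh2 s) (hh0 s)
  let A : ℕ → Matrix S S ℝ := fun n => Matrix.of fun s t => ∫ u, T n t u * h s u ∂μ
  have lA : Tendsto A atTop (nhds V) := by
    refine tendsto_pi_nhds.2 fun s => tendsto_pi_nhds.2 fun t => ?_
    have := tendsto_integral_const_mul (hh2 s) (fun n => hT n t) (hh2 t) (lT t)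
    exact this.congr fun n => by simp only [A, Matrix.of_apply, mul_comm]
  let r : ℕ → S → ℝ := fun n s => ∫ u, f u * h s u ∂μ - ∫ u, Tf n u * h s u ∂μ
  have lr : Tendsto r atTop (nhds 0) := by
    refine tendsto_pi_nhds.2 fun s => ?_
    have := tendsto_integral_const_mul (hh2 s) hTf hf2 lTf
    have := (tendsto_const_nhds (x := ∫ u, h s u * f u ∂μ)).sub this
    rw [sub_self] at this
    exact this.congr fun n => by simp only [r, mul_comm]
  let c : ℕ → S → ℝ := fun n => (A n)⁻¹.mulVec (r n)
  have lc : Tendsto c atTop (nhds 0) := by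
    have := tendsto_matrix_mulVec (tendsto_matrix_inv lA hV) lr
    simpa using this
  have lcs : ∀ s, Tendsto (fun n => c n s) atTop (nhds 0) := fun s =>
    (tendsto_pi_nhds.1 lc) s
  let b : ℕ → U → ℝ := fun n u => Tf n u + ∑ s, c n s * T n s u
  have hb : ∀ n, MemLp (b n) 2 μ := fun n => memLp_lincomb _ (hTf n) (hT n)
  have hbg : ∀ n (g : U → ℝ), MemLp g 2 μ → ∫ u, b n u * g u ∂μ =
      ∫ u, Tf n u * g u ∂μ + ∑ s, c n s * ∫ u, T n s u * g u ∂μ := fun n g hg =>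
    integral_lincomb_mul _ (hTf n) (hT n) hg
  -- moments against `f`
  have lbg : ∀ (g : ℕ → U → ℝ) (g0 : U → ℝ), (∀ n, MemLp (g n) 2 μ) → MemLp g0 2 μ →
      Tendsto (fun n => ∫ u, (g n u - g0 u) ^ 2 ∂μ) atTop (nhds 0) →
      Tendsto (fun n => ∫ u, b n u * g n u ∂μ) atTop (nhds (∫ u, f u * g0 u ∂μ)) := by
    intro g g0 hg hg0 hgg
    have h1 := tendsto_integral_mul hTf hf2 hg hg0 lTf hgg
    have h2 := tendsto_finsetSum Finset.univ fun s _ =>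
      (lcs s).mul (tendsto_integral_mul (fun n => hT n s) (hh2 s) hg hg0 (lT s) hgg)
    have h3 := h1.add h2
    simp only [zero_mul, Finset.sum_const_zero, add_zero] at h3
    exact h3.congr fun n => (hbg n (g n) (hg n)).symm
  have lbf : Tendsto (fun n => ∫ u, b n u * f u ∂μ) atTop (nhds (∫ u, f u ^ 2 ∂μ)) := by
    have := lbg (fun _ => f) f (fun _ => hf2) hf2 (by simp)
    simpa only [← sq] using this
  have lbb : Tendsto (fun n => ∫ u, b n u ^ 2 ∂μ) atTop (nhds (∫ u, f u ^ 2 ∂μ)) := by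
    have h1 := lbg Tf f hTf hf2 lTf
    have h2 := tendsto_finsetSum Finset.univ fun s _ =>
      (lcs s).mul (lbg (fun n => T n s) (h s) (fun n => hT n s) (hh2 s) (lT s))
    have h3 := h1.add h2
    simp only [zero_mul, Finset.sum_const_zero, add_zero, ← sq] at h3
    refine h3.congr fun n => ?_
    simp only [sq (b n _)]
    rw [hbg n (b n) (hb n)]
    simp only [mul_comm]
  have e1 : ∀ᶠ n in atTop, |∫ u, b n u * f u ∂μ - ∫ u, f u ^ 2 ∂μ| < ε := by
    have := (Metric.tendsto_nhds.1 lbf) ε hε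
    simpa only [Real.dist_eq] using this
  have e2 : ∀ᶠ n in atTop, ∫ u, b n u ^ 2 ∂μ < ∫ u, f u ^ 2 ∂μ + ε :=
    lbb.eventually_lt_const (by linarith)
  have e3 : ∀ᶠ n in atTop, (A n).det ≠ 0 :=
    ((continuous_id.matrix_det.tendsto V).comp lA).eventually_ne hV
  obtain ⟨n, h1, h2, h3⟩ := (e1.and (e2.and e3)).exists
  have hTfK : ∀ u, |Tf n u| ≤ 2 * n := abs_centeredTrunc_le f n
  have hTK : ∀ s u, |T n s u| ≤ 2 * n := fun s => abs_centeredTrunc_le (h s) n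
  have hsum : 0 ≤ ∑ s, |c n s| * (2 * n : ℝ) :=
    Finset.sum_nonneg fun s _ => by positivity
  refine ⟨b n, T n, 2 * n + ∑ s, |c n s| * (2 * n), ?_, fun s => measurable_centeredTrunc (hh s) n,
    fun u => ?_, fun s u => ?_, ?_, fun s => integral_centeredTrunc (hh s) n, fun s => ?_,
    h1, h2, h3⟩
  · exact (measurable_centeredTrunc hf n).add
      (Finset.measurable_fun_sum _ fun s _ => (measurable_centeredTrunc (hh s) n).const_mul _)
  · refine (abs_add_le _ _).trans (add_le_add (hTfK u) ?_)
    refine (Finset.abs_sum_le_sum_abs _ _).trans (Finset.sum_le_sum fun s _ => ?_)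
    rw [abs_mul]
    exact mul_le_mul_of_nonneg_left (hTK s u) (abs_nonneg _)
  · linarith [hTK s u]
  · have := hbg n (fun _ => 1) (memLp_const 1)
    simp only [mul_one] at this
    rw [this]
    simp [Tf, T, integral_centeredTrunc hf n, integral_centeredTrunc (hh _) n]
  · rw [hbg n (h s) (hh2 s)]
    have h4 : (A n).mulVec (c n) = r n := by
      simp only [c, Matrix.mulVec_mulVec]
      rw [Matrix.mul_nonsing_inv _ (isUnit_iff_ne_zero.2 h3), Matrix.one_mulVec]
    have h5 := congrFun h4 s
    simp only [Matrix.mulVec, dotProduct, A, Matrix.of_apply, r] at h5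
    simp only [mul_comm (c n _)]
    rw [h5]
    ring

/-- Along the curve `θ0 + t • τ` there are bounded perturbations `1 + m` of the reference density
that satisfy the moment conditions exactly, with `m` close to `t • f θ0` in `L²`. -/
theorem eventually_exists_perturbation {U : Type*} [MeasurableSpace U] {μ : Measure U}
    [IsProbabilityMeasure μ] {S : Type*} [Fintype S] [DecidableEq S]
    {E : Type*} [NormedAddCommGroup E] [NormedSpace ℝ E] {Θ : Set E} {θ0 : E}
    (hint : θ0 ∈ interior Θ) {h : E → S → U → ℝ} {f : E → U → ℝ}
    (hfm : Measurable (f θ0)) (hf2 : ∀ θ, MemLp (f θ) 2 μ)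
    (hhm : ∀ s, Measurable (h θ0 s)) (hh2 : ∀ θ s, MemLp (h θ s) 2 μ)
    (hf0 : ∫ u, f θ0 u ∂μ = 0) (hh0 : ∀ s, ∫ u, h θ0 s u ∂μ = 0)
    (hfL : Tendsto (fun θ => ∫ u, (f θ u - f θ0 u) ^ 2 ∂μ) (nhdsWithin θ0 Θ) (nhds 0))
    (hhL : ∀ s, Tendsto (fun θ => ∫ u, (h θ s u - h θ0 s u) ^ 2 ∂μ) (nhdsWithin θ0 Θ) (nhds 0))
    (hV : (Matrix.of fun s t => ∫ u, h θ0 s u * h θ0 t u ∂μ).det ≠ 0)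
    {H' : E →L[ℝ] (S → ℝ)} (hH : HasFDerivAt (fun θ s => ∫ u, h θ s u ∂μ) H' θ0)
    (hq : HasFDerivAt (fun θ => ∫ u, f θ u ∂μ) (0 : E →L[ℝ] ℝ) θ0)
    {τ : E} (hτ : ∀ s, H' τ s = -∫ u, f θ0 u * h θ0 s u ∂μ) {ε : ℝ} (hε : 0 < ε) :
    ∀ᶠ t in nhdsWithin (0 : ℝ) {0}ᶜ, ∃ θ ∈ Θ, ∃ m : U → ℝ, Measurable m ∧
      (∃ K, ∀ u, |m u| ≤ K) ∧ (∀ u, -1 ≤ m u) ∧ ∫ u, m u ∂μ = 0 ∧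
      ∫ u, m u ^ 2 ∂μ ≤ t ^ 2 * (∫ u, f θ0 u ^ 2 ∂μ + ε) ∧
      (∀ s, ∫ u, h θ s u ∂μ + ∫ u, m u * h θ s u ∂μ = 0) ∧
      |∫ u, f θ u ∂μ + ∫ u, m u * f θ u ∂μ - t * ∫ u, f θ0 u ^ 2 ∂μ| ≤ ε * |t| := by
  obtain ⟨b, B, K, hbm, hBm, hbK, hBK, hb0, hB0, hbh, hbf, hbb, hdet⟩ :=
    exists_bounded_approx hfm (hf2 θ0) hf0 hhm (hh2 θ0) hh0 hV hε
  have hb2 : MemLp b 2 μ := memLp_two_of_abs_le hbm hbK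
  have hB2 : ∀ s, MemLp (B s) 2 μ := fun s => memLp_two_of_abs_le (hBm s) (hBK s)
  have hθ : Tendsto (fun t : ℝ => θ0 + t • τ) (nhdsWithin 0 {0}ᶜ) (nhdsWithin θ0 Θ) := by
    rw [nhdsWithin_eq_nhds.2 (mem_interior_iff_mem_nhds.1 hint)]
    refine Tendsto.mono_left ?_ nhdsWithin_le_nhds
    have : Continuous fun t : ℝ => θ0 + t • τ := by fun_prop
    simpa using this.tendsto 0
  have hHs : Tendsto (fun t : ℝ => fun s => t⁻¹ * ∫ u, h (θ0 + t • τ) s u ∂μ)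
      (nhdsWithin 0 {0}ᶜ) (nhds (H' τ)) := by
    have := hasDerivAt_iff_tendsto_slope_zero.1 (hH.hasLineDerivAt τ)
    refine this.congr fun t => ?_
    ext s
    simp [hh0]
  have hqs : Tendsto (fun t : ℝ => t⁻¹ * ∫ u, f (θ0 + t • τ) u ∂μ)
      (nhdsWithin 0 {0}ᶜ) (nhds 0) := by
    have := hasDerivAt_iff_tendsto_slope_zero.1 (hq.hasLineDerivAt τ)
    refine (this.congr fun t => ?_)
    simp [hf0]
  let A : E → Matrix S S ℝ := fun θ => Matrix.of fun s t => ∫ u, B t u * h θ s u ∂μ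
  have lA : Tendsto (fun t : ℝ => A (θ0 + t • τ)) (nhdsWithin 0 {0}ᶜ) (nhds (A θ0)) := by
    refine tendsto_pi_nhds.2 fun s => tendsto_pi_nhds.2 fun t => ?_
    exact tendsto_integral_const_mul (hB2 t) (fun r => hh2 _ s) (hh2 θ0 s) ((hhL s).comp hθ)
  let v : ℝ → S → ℝ := fun t s =>
    -(t⁻¹ * ∫ u, h (θ0 + t • τ) s u ∂μ + ∫ u, b u * h (θ0 + t • τ) s u ∂μ)
  have lv : Tendsto v (nhdsWithin 0 {0}ᶜ) (nhds 0) := by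
    refine tendsto_pi_nhds.2 fun s => ?_
    have h1 := tendsto_integral_const_mul hb2 (fun r : ℝ => hh2 (θ0 + r • τ) s) (hh2 θ0 s)
      ((hhL s).comp hθ)
    have h2 := ((tendsto_pi_nhds.1 hHs s).add h1).neg
    rw [hτ, hbh, neg_add_cancel, neg_zero] at h2
    exact h2
  let d : ℝ → S → ℝ := fun t => (A (θ0 + t • τ))⁻¹.mulVec (v t)
  have ld : Tendsto d (nhdsWithin 0 {0}ᶜ) (nhds 0) := by
    simpa using tendsto_matrix_mulVec (tendsto_matrix_inv lA hdet) lv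
  have lds : ∀ s, Tendsto (fun t => d t s) (nhdsWithin 0 {0}ᶜ) (nhds 0) := tendsto_pi_nhds.1 ld
  let w : ℝ → U → ℝ := fun t u => b u + ∑ s, d t s * B s u
  have hwg : ∀ t (g : U → ℝ), MemLp g 2 μ → ∫ u, w t u * g u ∂μ =
      ∫ u, b u * g u ∂μ + ∑ s, d t s * ∫ u, B s u * g u ∂μ := fun t g hg =>
    integral_lincomb_mul _ hb2 hB2 hg
  have hw2 : ∀ t, MemLp (w t) 2 μ := fun t => memLp_lincomb _ hb2 hB2
  have hwm : ∀ t, Measurable (w t) := fun t =>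
    hbm.add (Finset.measurable_fun_sum _ fun s _ => (hBm s).const_mul _)
  have hwK : ∀ t u, |w t u| ≤ K + ∑ s, |d t s| * K := by
    intro t u
    refine (abs_add_le _ _).trans (add_le_add (hbK u) ?_)
    refine (Finset.abs_sum_le_sum_abs _ _).trans (Finset.sum_le_sum fun s _ => ?_)
    rw [abs_mul]
    exact mul_le_mul_of_nonneg_left (hBK s u) (abs_nonneg _)
  have lww : Tendsto (fun t => ∫ u, w t u ^ 2 ∂μ) (nhdsWithin 0 {0}ᶜ)
      (nhds (∫ u, b u ^ 2 ∂μ)) := by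
    have key : ∀ g : U → ℝ, MemLp g 2 μ → Tendsto (fun t => ∫ u, g u * w t u ∂μ)
        (nhdsWithin 0 {0}ᶜ) (nhds (∫ u, g u * b u ∂μ)) := by
      intro g hg
      have h2 := tendsto_finsetSum Finset.univ fun s _ =>
        (lds s).mul (tendsto_const_nhds (x := ∫ u, B s u * g u ∂μ))
      have h3 := (tendsto_const_nhds (x := ∫ u, b u * g u ∂μ)).add h2
      simp only [zero_mul, Finset.sum_const_zero, add_zero, ← hwg _ g hg] at h3
      simpa only [mul_comm] using h3
    have h2 := tendsto_finsetSum Finset.univ fun s _ => (lds s).mul (key (B s) (hB2 s))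
    have h3 := (key b hb2).add h2
    simp only [zero_mul, Finset.sum_const_zero, add_zero, ← sq] at h3
    refine h3.congr fun t => ?_
    simp only [sq (w t _)]
    rw [hwg t (w t) (hw2 t)]
  have lwf : Tendsto (fun t : ℝ => t⁻¹ * ∫ u, f (θ0 + t • τ) u ∂μ +
      ∫ u, w t u * f (θ0 + t • τ) u ∂μ) (nhdsWithin 0 {0}ᶜ) (nhds (∫ u, b u * f θ0 u ∂μ)) := by
    have h0 : ∀ g : U → ℝ, MemLp g 2 μ → Tendsto (fun t : ℝ => ∫ u, g u * f (θ0 + t • τ) u ∂μ)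
        (nhdsWithin 0 {0}ᶜ) (nhds (∫ u, g u * f θ0 u ∂μ)) := fun g hg =>
      tendsto_integral_const_mul hg (fun _ => hf2 _) (hf2 θ0) (hfL.comp hθ)
    have h2 := tendsto_finsetSum Finset.univ fun s _ => (lds s).mul (h0 (B s) (hB2 s))
    have h3 := hqs.add ((h0 b hb2).add h2)
    simp only [zero_mul, Finset.sum_const_zero, add_zero, zero_add] at h3
    refine h3.congr fun t => ?_
    rw [hwg t _ (hf2 _)]
  have lbd : Tendsto (fun t : ℝ => |t| * (K + ∑ s, |d t s| * K)) (nhdsWithin 0 {0}ᶜ) (nhds 0) := by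
    have h1 : Tendsto (fun t : ℝ => |t|) (nhdsWithin 0 {0}ᶜ) (nhds 0) := by
      refine Tendsto.mono_left ?_ nhdsWithin_le_nhds
      simpa using (continuous_abs (G := ℝ)).tendsto 0
    have h2 := tendsto_finsetSum Finset.univ fun s _ => ((lds s).abs.mul_const K)
    simpa using h1.mul ((tendsto_const_nhds (x := K)).add h2)
  have e1 : ∀ᶠ t : ℝ in nhdsWithin 0 {0}ᶜ, |t| * (K + ∑ s, |d t s| * K) < 1 :=
    lbd.eventually_lt_const one_pos
  have e2 : ∀ᶠ t : ℝ in nhdsWithin 0 {0}ᶜ, ∫ u, w t u ^ 2 ∂μ < ∫ u, f θ0 u ^ 2 ∂μ + ε :=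
    lww.eventually_lt_const hbb
  have e3 : ∀ᶠ t : ℝ in nhdsWithin 0 {0}ᶜ, |t⁻¹ * ∫ u, f (θ0 + t • τ) u ∂μ +
      ∫ u, w t u * f (θ0 + t • τ) u ∂μ - ∫ u, f θ0 u ^ 2 ∂μ| < ε :=
    (lwf.sub_const _).abs.eventually_lt_const hbf
  have e4 : ∀ᶠ t : ℝ in nhdsWithin 0 {0}ᶜ, (A (θ0 + t • τ)).det ≠ 0 :=
    ((continuous_id.matrix_det.tendsto (A θ0)).comp lA).eventually_ne hdet
  have e5 : ∀ᶠ t : ℝ in nhdsWithin 0 {0}ᶜ, θ0 + t • τ ∈ Θ :=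
    hθ.eventually self_mem_nhdsWithin
  filter_upwards [e1, e2, e3, e4, e5, self_mem_nhdsWithin] with t h1 h2 h3 h4 h5 ht
  have ht0 : t ≠ 0 := ht
  have hmK : ∀ u, |t * w t u| ≤ 1 := fun u => by
    rw [abs_mul]
    exact (mul_le_mul_of_nonneg_left (hwK t u) (abs_nonneg t)).trans h1.le
  refine ⟨θ0 + t • τ, h5, fun u => t * w t u, (hwm t).const_mul t, ⟨1, hmK⟩,
    fun u => (abs_le.1 (hmK u)).1, ?_, ?_, fun s => ?_, ?_⟩
  · have := hwg t (fun _ => 1) (memLp_const 1)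
    simp only [mul_one, hb0, hB0, mul_zero, Finset.sum_const_zero, add_zero] at this
    rw [integral_const_mul, this, mul_zero]
  · simp only [mul_pow]
    rw [integral_const_mul]
    exact mul_le_mul_of_nonneg_left h2.le (sq_nonneg t)
  · simp only [mul_assoc]
    rw [integral_const_mul, hwg t _ (hh2 _ s)]
    have h6 : (A (θ0 + t • τ)).mulVec (d t) = v t := by
      simp only [d, Matrix.mulVec_mulVec]
      rw [Matrix.mul_nonsing_inv _ (isUnit_iff_ne_zero.2 h4), Matrix.one_mulVec]
    have h7 := congrFun h6 s
    simp only [Matrix.mulVec, dotProduct, A, Matrix.of_apply, v] at h7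
    simp only [mul_comm (d t _)]
    rw [h7]
    field_simp
    ring
  · simp only [mul_assoc]
    rw [integral_const_mul]
    have : ∫ u, f (θ0 + t • τ) u ∂μ + t * ∫ u, w t u * f (θ0 + t • τ) u ∂μ -
        t * ∫ u, f θ0 u ^ 2 ∂μ = (t⁻¹ * ∫ u, f (θ0 + t • τ) u ∂μ +
      ∫ u, w t u * f (θ0 + t • τ) u ∂μ - ∫ u, f θ0 u ^ 2 ∂μ) * t := by
      field_simp
    rw [this, abs_mul]
    exact mul_le_mul_of_nonneg_right h3.le (abs_nonneg t)

theorem exists_pos_forall_norm_lt_mem {E F : Type*} [TopologicalSpace E] [NormedAddCommGroup F]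
    {Θ : Set E} (hΘ : IsCompact Θ) {G : E → F} (hG : ContinuousOn G Θ) {θ0 : E}
    (huniq : ∀ θ ∈ Θ, G θ = 0 → θ = θ0) {N : Set E} (hN : N ∈ nhdsWithin θ0 Θ) :
    ∃ c > 0, ∀ θ ∈ Θ, ‖G θ‖ < c → θ ∈ N := by
  obtain ⟨O, hO, h0, hON⟩ := mem_nhdsWithin.1 hN
  have hK : IsCompact (Θ \ O) := hΘ.diff hO
  rcases (Θ \ O).eq_empty_or_nonempty with he | hne
  · refine ⟨1, one_pos, fun θ hθ _ => hON ⟨?_, hθ⟩⟩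
    by_contra hc
    exact he.le ⟨hθ, hc⟩
  · obtain ⟨x, hx, hmin⟩ := hK.exists_isMinOn hne (hG.norm.mono sdiff_subset)
    refine ⟨‖G x‖, ?_, fun θ hθ hlt => hON ⟨?_, hθ⟩⟩
    · refine norm_pos_iff.2 fun h => hx.2 ?_
      rw [huniq x hx.1 h]
      exact h0
    · by_contra hc
      exact absurd (hmin ⟨hθ, hc⟩) (not_le.2 hlt)

/-- Uniform upper bound for the effect of a small `L²` perturbation `m` of the reference density
satisfying the moment conditions at some `θ ∈ Θ`. -/
theorem eventually_abs_perturbation_le {U : Type*} [MeasurableSpace U] {μ : Measure U}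
    [IsProbabilityMeasure μ] {S : Type*} [Fintype S]
    {E : Type*} [NormedAddCommGroup E] [NormedSpace ℝ E] {Θ : Set E} (hΘ : IsCompact Θ) {θ0 : E}
    (hθ0 : θ0 ∈ Θ) {h : E → S → U → ℝ} {f : E → U → ℝ}
    (hf2 : ∀ θ, MemLp (f θ) 2 μ) (hh2 : ∀ θ s, MemLp (h θ s) 2 μ)
    (hf0 : ∫ u, f θ0 u ∂μ = 0) (hh0 : ∀ s, ∫ u, h θ0 s u ∂μ = 0)
    (huniq : ∀ θ ∈ Θ, (∀ s, ∫ u, h θ s u ∂μ = 0) → θ = θ0)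
    (hfL : Tendsto (fun θ => ∫ u, (f θ u - f θ0 u) ^ 2 ∂μ) (nhdsWithin θ0 Θ) (nhds 0))
    (hhL : ∀ θ1 ∈ Θ, ∀ s, Tendsto (fun θ => ∫ u, (h θ s u - h θ1 s u) ^ 2 ∂μ)
      (nhdsWithin θ1 Θ) (nhds 0))
    {H' : E →L[ℝ] (S → ℝ)} (hH : HasFDerivAt (fun θ s => ∫ u, h θ s u ∂μ) H' θ0)
    (hH' : Topology.IsInducing H')
    (hq : HasFDerivAt (fun θ => ∫ u, f θ u ∂μ) (0 : E →L[ℝ] ℝ) θ0) {ε : ℝ} (hε : 0 < ε) :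
    ∀ᶠ δ in nhdsWithin (0 : ℝ) (Set.Ioi 0), ∀ θ ∈ Θ, ∀ m : U → ℝ, MemLp m 2 μ →
      ∫ u, m u ^ 2 ∂μ ≤ 2 * δ → (∀ s, ∫ u, h θ s u ∂μ + ∫ u, m u * h θ s u ∂μ = 0) →
      |∫ u, f θ u ∂μ + ∫ u, m u * f θ u ∂μ| ≤ √(2 * δ) * (√(∫ u, f θ0 u ^ 2 ∂μ) + ε) := by
  set G : E → S → ℝ := fun θ s => ∫ u, h θ s u ∂μ with hGdef
  have hGc : ContinuousOn G Θ := by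
    refine continuousOn_pi.2 fun s θ1 hθ1 => ?_
    have := tendsto_integral_const_mul (memLp_const (μ := μ) (1 : ℝ)) (fun θ => hh2 θ s) (hh2 θ1 s)
      (hhL θ1 hθ1 s)
    simp only [one_mul] at this
    exact this
  -- uniform bound on the second moments of `h`
  obtain ⟨D, hD0, hD⟩ : ∃ D : ℝ, 0 ≤ D ∧ ∀ θ ∈ Θ, ∀ s, √(∫ u, h θ s u ^ 2 ∂μ) ≤ D := by
    have hc : ∀ s, ContinuousOn (fun θ => √(∫ u, h θ s u ^ 2 ∂μ)) Θ := fun s θ1 hθ1 => by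
      have := tendsto_integral_mul (fun θ => hh2 θ s) (hh2 θ1 s) (fun θ => hh2 θ s) (hh2 θ1 s)
        (hhL θ1 hθ1 s) (hhL θ1 hθ1 s)
      simp only [← sq] at this
      exact this.sqrt
    have hsum : ContinuousOn (fun θ => ∑ s, √(∫ u, h θ s u ^ 2 ∂μ)) Θ :=
      continuousOn_finsetSum _ fun s _ => hc s
    obtain ⟨D, hD⟩ := hΘ.bddAbove_image hsum
    have hD' : ∀ θ ∈ Θ, ∑ s, √(∫ u, h θ s u ^ 2 ∂μ) ≤ D := fun θ hθ => hD ⟨θ, hθ, rfl⟩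
    refine ⟨D, (Finset.sum_nonneg fun s _ => Real.sqrt_nonneg _).trans (hD' θ0 hθ0),
      fun θ hθ s => le_trans ?_ (hD' θ hθ)⟩
    exact Finset.single_le_sum (f := fun s => √(∫ u, h θ s u ^ 2 ∂μ))
      (fun s _ => Real.sqrt_nonneg _) (Finset.mem_univ s)
  have hG0 : G θ0 = 0 := funext hh0
  -- local comparison of the two means
  have hlit : (fun θ => ∫ u, f θ u ∂μ) =o[nhds θ0] G := by
    have h1 := hq.isLittleO
    have h3 := h1.trans_isTheta (hH.isTheta_sub hH').symm
    simpa [hf0, hG0] using h3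
  have hε' : 0 < ε / 2 / (D + 1) := by positivity
  have n1 : ∀ᶠ θ in nhdsWithin θ0 Θ, ‖∫ u, f θ u ∂μ‖ ≤ ε / 2 / (D + 1) * ‖G θ‖ :=
    nhdsWithin_le_nhds (hlit.bound hε')
  have n2 : ∀ᶠ θ in nhdsWithin θ0 Θ, √(∫ u, (f θ u - f θ0 u) ^ 2 ∂μ) < ε / 2 := by
    have := hfL.sqrt
    rw [Real.sqrt_zero] at this
    exact this.eventually_lt_const (half_pos hε)
  obtain ⟨c, hc, hcN⟩ := exists_pos_forall_norm_lt_mem hΘ hGc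
    (fun θ hθ h0 => huniq θ hθ fun s => congrFun h0 s) (n1.and n2)
  have e1 : ∀ᶠ δ in nhdsWithin (0 : ℝ) (Set.Ioi 0), √(2 * δ) * D < c := by
    have h1 : Continuous fun δ : ℝ => √(2 * δ) * D := by fun_prop
    have h2 := (h1.tendsto 0).mono_left (nhdsWithin_le_nhds (s := Set.Ioi 0))
    simp only [mul_zero, Real.sqrt_zero, zero_mul] at h2
    exact h2.eventually_lt_const hc
  filter_upwards [e1] with δ h1 θ hθ m hm hmδ hmh
  have hmr : √(∫ u, m u ^ 2 ∂μ) ≤ √(2 * δ) := Real.sqrt_le_sqrt hmδ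
  have hGn : ‖G θ‖ ≤ √(2 * δ) * D := by
    refine (pi_norm_le_iff_of_nonneg (by positivity)).2 fun s => ?_
    have : G θ s = -∫ u, m u * h θ s u ∂μ := by linarith [hmh s]
    rw [this, norm_neg]
    exact (abs_integral_mul_le_sqrt hm (hh2 θ s)).trans
      (mul_le_mul hmr (hD θ hθ s) (Real.sqrt_nonneg _) (Real.sqrt_nonneg _))
  obtain ⟨h2, h3⟩ := hcN θ hθ (hGn.trans_lt h1)
  have b1 : |∫ u, f θ u ∂μ| ≤ √(2 * δ) * (ε / 2) := by
    refine h2.trans ((mul_le_mul_of_nonneg_left hGn hε'.le).trans ?_)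
    have : ε / 2 / (D + 1) * (√(2 * δ) * D) = √(2 * δ) * (ε / 2) * (D / (D + 1)) := by
      field_simp
    rw [this]
    refine mul_le_of_le_one_right (by positivity) ?_
    rw [div_le_one (by positivity)]
    linarith
  have b2 : |∫ u, m u * f θ0 u ∂μ| ≤ √(2 * δ) * √(∫ u, f θ0 u ^ 2 ∂μ) :=
    (abs_integral_mul_le_sqrt hm (hf2 θ0)).trans
      (mul_le_mul_of_nonneg_right hmr (Real.sqrt_nonneg _))
  have b3 : |∫ u, m u * (f θ u - f θ0 u) ∂μ| ≤ √(2 * δ) * (ε / 2) :=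
    (abs_integral_mul_le_sqrt hm ((hf2 θ).sub (hf2 θ0))).trans
      (mul_le_mul hmr h3.le (Real.sqrt_nonneg _) (Real.sqrt_nonneg _))
  have hsplit : ∫ u, m u * f θ u ∂μ =
      ∫ u, m u * f θ0 u ∂μ + ∫ u, m u * (f θ u - f θ0 u) ∂μ := by
    have i1 : Integrable (fun u => m u * f θ0 u) μ := hm.integrable_mul (hf2 θ0)
    have i2 : Integrable (fun u => m u * (f θ u - f θ0 u)) μ :=
      hm.integrable_mul ((hf2 θ).sub (hf2 θ0))
    rw [← integral_add i1 i2]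
    congr 1
    ext u
    ring
  rw [hsplit]
  rw [abs_le] at *
  constructor <;> linarith

section Density

variable {U : Type*} [MeasurableSpace U] {μ : Measure U} [IsProbabilityMeasure μ]

/-- A probability measure within `χ²`-divergence `δ` of `μ` is a perturbation of `μ` with
square-integrable relative density. -/
theorem exists_perturbation_of_Dphi_le {F : Measure U} [IsProbabilityMeasure F] {δ : ℝ}
    (hδ : 0 ≤ δ) (hF : Dphi chiSq μ F ≤ ENNReal.ofReal δ) :
    ∃ m : U → ℝ, MemLp m 2 μ ∧ ∫ u, m u ∂μ = 0 ∧ ∫ u, m u ^ 2 ∂μ ≤ 2 * δ ∧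
      ∀ g : U → ℝ, MemLp g 2 μ → ∫ u, g u ∂F = ∫ u, g u ∂μ + ∫ u, m u * g u ∂μ := by
  have hac : F ≪ μ := by
    by_contra hc
    simp [Dphi, hc] at hF
  simp only [Dphi, hac, if_true, chiSq] at hF
  let m : U → ℝ := fun u => (F.rnDeriv μ u).toReal - 1
  have hmm : Measurable m := (Measure.measurable_rnDeriv F μ).ennreal_toReal.sub_const 1
  have hnn : ∀ u, 0 ≤ m u ^ 2 / 2 := fun u => by positivity
  have hi : Integrable (fun u => m u ^ 2 / 2) μ := by
    refine ⟨((hmm.pow_const 2).div_const 2).aestronglyMeasurable, ?_⟩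
    rw [hasFiniteIntegral_iff_ofReal (ae_of_all _ hnn)]
    exact hF.trans_lt ENNReal.ofReal_lt_top
  have hm2 : MemLp m 2 μ := by
    rw [memLp_two_iff_integrable_sq hmm.aestronglyMeasurable]
    simpa [mul_div_cancel₀] using hi.mul_const 2
  have hmain : ∀ g : U → ℝ, MemLp g 2 μ →
      ∫ u, g u ∂F = ∫ u, g u ∂μ + ∫ u, m u * g u ∂μ := by
    intro g hg
    have i2 : Integrable (fun u => m u * g u) μ := hm2.integrable_mul hg
    rw [← integral_add (hg.integrable one_le_two) i2, ← integral_rnDeriv_smul hac]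
    congr 1
    ext u
    simp only [m, smul_eq_mul]
    ring
  refine ⟨m, hm2, ?_, ?_, hmain⟩
  · have := hmain (fun _ => 1) (memLp_const 1)
    simpa using this
  · have h1 : ∫ u, m u ^ 2 / 2 ∂μ ≤ δ := by
      rw [integral_eq_lintegral_of_nonneg_ae (ae_of_all _ hnn) hi.1]
      exact ENNReal.toReal_le_of_le_ofReal hδ hF
    rw [integral_div] at h1
    linarith

/-- A bounded perturbation `1 + m ≥ 0` of mean one is the density of a probability measure whose
`χ²`-divergence is half the second moment of `m`. -/
theorem exists_measure_of_perturbation {m : U → ℝ} (hm : Measurable m) {K : ℝ}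
    (hK : ∀ u, |m u| ≤ K) (hm1 : ∀ u, -1 ≤ m u) (hm0 : ∫ u, m u ∂μ = 0) {δ : ℝ}
    (hδ : ∫ u, m u ^ 2 ∂μ ≤ 2 * δ) :
    ∃ F : Measure U, IsProbabilityMeasure F ∧ Dphi chiSq μ F ≤ ENNReal.ofReal δ ∧
      ∀ g : U → ℝ, MemLp g 2 μ →
        Integrable g F ∧ ∫ u, g u ∂F = ∫ u, g u ∂μ + ∫ u, m u * g u ∂μ := by
  have hm2 : MemLp m 2 μ := memLp_two_of_abs_le hm hK
  have hnn : ∀ u, 0 ≤ 1 + m u := fun u => by linarith [hm1 u]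
  let r : U → ℝ≥0∞ := fun u => ENNReal.ofReal (1 + m u)
  have hrm : Measurable r := (hm.const_add 1).ennreal_ofReal
  have hrt : ∀ u, (r u).toReal = 1 + m u := fun u => ENNReal.toReal_ofReal (hnn u)
  have hac : μ.withDensity r ≪ μ := withDensity_absolutelyContinuous μ r
  have hi1 : Integrable (fun u => 1 + m u) μ :=
    (integrable_const 1).add (hm2.integrable one_le_two)
  have hprob : IsProbabilityMeasure (μ.withDensity r) := by
    refine ⟨?_⟩
    rw [withDensity_apply _ MeasurableSet.univ, Measure.restrict_univ,
      ← ofReal_integral_eq_lintegral_ofReal hi1 (ae_of_all _ hnn),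
      integral_add (integrable_const 1) (hm2.integrable one_le_two), hm0]
    simp
  refine ⟨μ.withDensity r, hprob, ?_, fun g hg => ?_⟩
  · simp only [Dphi, hac, if_true, chiSq]
    have h1 : ∫⁻ u, ENNReal.ofReal ((((μ.withDensity r).rnDeriv μ u).toReal - 1) ^ 2 / 2) ∂μ =
        ∫⁻ u, ENNReal.ofReal (m u ^ 2 / 2) ∂μ := by
      refine lintegral_congr_ae ?_
      filter_upwards [Measure.rnDeriv_withDensity μ hrm] with u hu
      rw [hu, hrt, add_sub_cancel_left]
    rw [h1, ← ofReal_integral_eq_lintegral_ofReal (hm2.integrable_sq.div_const 2)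
      (ae_of_all _ fun u => by positivity), integral_div]
    exact ENNReal.ofReal_le_ofReal (by linarith)
  · have hlt : ∀ᵐ u ∂μ, r u < ⊤ := ae_of_all _ fun u => ENNReal.ofReal_lt_top
    have i1 := hg.integrable one_le_two
    have i2 : Integrable (fun u => m u * g u) μ := hm2.integrable_mul hg
    have h1 : (fun u => (r u).toReal • g u) = fun u => g u + m u * g u := by
      ext u
      rw [hrt, smul_eq_mul]
      ring
    constructor
    · rw [integrable_withDensity_iff_integrable_smul' hrm hlt, h1]
      exact i1.add i2
    · rw [integral_withDensity_eq_integral_toReal_smul hrm hlt, h1, integral_add i1 i2]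

end Density

theorem mulVec_injective_of_rank_eq {m n : Type*} [Fintype m] [Fintype n] {A : Matrix m n ℝ}
    (h : A.rank = Fintype.card n) : Function.Injective A.mulVec := by
  have h1 := LinearMap.finrank_range_add_finrank_ker A.mulVecLin
  rw [← Matrix.rank, h, Module.finrank_pi] at h1
  have h2 : Module.finrank ℝ (LinearMap.ker A.mulVecLin) = 0 := by omega
  exact LinearMap.ker_eq_bot.1 (Submodule.finrank_eq_zero.1 h2)

section Multiplier

variable {S T : Type*} [Fintype S] [DecidableEq S] [Fintype T] [DecidableEq T]

/-- The first-order adjustment of the parameter along the least favourable direction. -/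
def adjustment (H : Matrix S T ℝ) (V : Matrix S S ℝ) (c : S → ℝ) (J : T → ℝ) : T → ℝ :=
  (H.transpose * V⁻¹ * H)⁻¹.mulVec (H.transpose.mulVec (V⁻¹.mulVec c) - J)

/-- The multiplier on the moment conditions in the influence function. -/
def multiplier (H : Matrix S T ℝ) (V : Matrix S S ℝ) (c : S → ℝ) (J : T → ℝ) : S → ℝ :=
  V⁻¹.mulVec (c - H.mulVec (adjustment H V c J))

theorem mulVec_multiplier {H : Matrix S T ℝ} {V : Matrix S S ℝ} (hV : V.PosDef)
    (c : S → ℝ) (J : T → ℝ) :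
    V.mulVec (multiplier H V c J) = c - H.mulVec (adjustment H V c J) := by
  rw [multiplier, Matrix.mulVec_mulVec, Matrix.mul_nonsing_inv _ hV.det_pos.ne'.isUnit,
    Matrix.one_mulVec]

theorem transpose_mulVec_multiplier {H : Matrix S T ℝ} {V : Matrix S S ℝ} (hV : V.PosDef)
    (hH : Function.Injective H.mulVec) (c : S → ℝ) (J : T → ℝ) :
    H.transpose.mulVec (multiplier H V c J) = J := by
  have hW : (H.transpose * V⁻¹ * H).PosDef := by
    have := hV.inv.conjTranspose_mul_mul_same hH
    rwa [Matrix.conjTranspose_eq_transpose_of_trivial] at this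
  have h1 : H.transpose.mulVec (V⁻¹.mulVec (H.mulVec (adjustment H V c J))) =
      H.transpose.mulVec (V⁻¹.mulVec c) - J := by
    rw [Matrix.mulVec_mulVec, Matrix.mulVec_mulVec, adjustment, Matrix.mulVec_mulVec,
      Matrix.mul_nonsing_inv _ hW.det_pos.ne'.isUnit, Matrix.one_mulVec]
  rw [multiplier, Matrix.mulVec_sub, Matrix.mulVec_sub, h1, sub_sub_cancel]

theorem dot_multiplier {H : Matrix S T ℝ} {V : Matrix S S ℝ} (hV : V.PosDef)
    (c : S → ℝ) (J : T → ℝ) (x : S → ℝ) :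
    dot (multiplier H V c J) x =
      dot c ((V⁻¹ - V⁻¹ * H * (H.transpose * V⁻¹ * H)⁻¹ * H.transpose * V⁻¹).mulVec x) +
        dot J (((H.transpose * V⁻¹ * H)⁻¹ * H.transpose * V⁻¹).mulVec x) := by
  have hVt : V⁻¹.transpose = V⁻¹ := by
    have := hV.inv.isHermitian.eq
    rwa [Matrix.conjTranspose_eq_transpose_of_trivial] at this
  have hWt : (H.transpose * V⁻¹ * H)⁻¹.transpose = (H.transpose * V⁻¹ * H)⁻¹ := by
    rw [Matrix.transpose_nonsing_inv]
    simp only [Matrix.transpose_mul, Matrix.transpose_transpose, hVt, Matrix.mul_assoc]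
  rw [multiplier, adjustment]
  generalize (H.transpose * V⁻¹ * H)⁻¹ = W at hWt ⊢
  generalize V⁻¹ = X at hVt ⊢
  change dotProduct _ _ = dotProduct _ _ + dotProduct _ _
  rw [Matrix.dotProduct_mulVec, Matrix.dotProduct_mulVec, ← add_dotProduct,
    ← Matrix.mulVec_transpose, ← Matrix.mulVec_transpose]
  congr 1
  simp only [Matrix.transpose_sub, Matrix.transpose_mul, Matrix.transpose_transpose, hVt, hWt,
    Matrix.mulVec_sub, Matrix.sub_mulVec, Matrix.mulVec_mulVec, Matrix.mul_assoc]
  exact sub_sub_eq_add_sub _ _ _ |>.trans (by rw [add_sub_right_comm])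

end Multiplier

section LinearCombination

variable {U : Type*} [MeasurableSpace U] {μ : Measure U}

theorem tendsto_integral_lincomb_sq {S ι : Type*} [Fintype S] {l : Filter ι} {b : ι → U → ℝ}
    {B : ι → S → U → ℝ} (c : S → ℝ) (hb : ∀ i, MemLp (b i) 2 μ) (hB : ∀ i s, MemLp (B i s) 2 μ)
    (hb0 : Tendsto (fun i => ∫ u, b i u ^ 2 ∂μ) l (nhds 0))
    (hB0 : ∀ s, Tendsto (fun i => ∫ u, B i s u ^ 2 ∂μ) l (nhds 0)) :
    Tendsto (fun i => ∫ u, (b i u + ∑ s, c s * B i s u) ^ 2 ∂μ) l (nhds 0) := by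
  have h1 : Tendsto (fun i => 2 * ∫ u, b i u ^ 2 ∂μ +
      2 * (∑ s, c s ^ 2) * ∑ s, ∫ u, B i s u ^ 2 ∂μ) l (nhds 0) := by
    have := (hb0.const_mul 2).add
      ((tendsto_finsetSum Finset.univ fun s _ => hB0 s).const_mul (2 * ∑ s, c s ^ 2))
    simpa using this
  refine tendsto_of_tendsto_of_tendsto_of_le_of_le tendsto_const_nhds h1
    (fun i => integral_nonneg fun u => sq_nonneg _) fun i => ?_
  have h2 : Integrable (fun u => 2 * b i u ^ 2) μ := (hb i).integrable_sq.const_mul 2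
  have h3 : ∀ s ∈ Finset.univ, Integrable (fun u => B i s u ^ 2) μ :=
    fun s _ => (hB i s).integrable_sq
  have h4 : Integrable (fun u => 2 * (∑ s, c s ^ 2) * ∑ s, B i s u ^ 2) μ :=
    (integrable_finsetSum _ h3).const_mul _
  rw [← integral_finsetSum _ h3, ← integral_const_mul, ← integral_const_mul,
    ← integral_add h2 h4]
  refine integral_mono (memLp_lincomb c (hb i) (hB i)).integrable_sq (h2.add h4) fun u => ?_
  have h5 := Finset.sum_mul_sq_le_sq_mul_sq Finset.univ c fun s => B i s u
  have h6 := sq_nonneg (b i u - ∑ s, c s * B i s u)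
  nlinarith

theorem integral_lincomb {S : Type*} [Fintype S] {b : U → ℝ} {B : S → U → ℝ}
    (c : S → ℝ) (hb : Integrable b μ) (hB : ∀ s, Integrable (B s) μ) :
    ∫ u, (b u + ∑ s, c s * B s u) ∂μ = ∫ u, b u ∂μ + ∑ s, c s * ∫ u, B s u ∂μ := by
  have h1 : ∀ s ∈ Finset.univ, Integrable (fun u => c s * B s u) μ :=
    fun s _ => (hB s).const_mul _
  rw [integral_add hb (integrable_finsetSum _ h1), integral_finsetSum _ h1]
  simp_rw [integral_const_mul]

end LinearCombination

theorem sub_le_div_sqrt {σ ε : ℝ} (hσ : 0 ≤ σ) (hε : 0 < ε) :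
    σ - ε ≤ (σ ^ 2 - (ε / 2) ^ 2) / √(σ ^ 2 + (ε / 2) ^ 2) := by
  have hp : 0 < σ ^ 2 + (ε / 2) ^ 2 := by positivity
  have hs := Real.sqrt_pos.2 hp
  have hq : √(σ ^ 2 + (ε / 2) ^ 2) ≤ σ + ε / 2 :=
    Real.sqrt_le_iff.2 ⟨by positivity, by nlinarith⟩
  have hr : ε / 2 ≤ √(σ ^ 2 + (ε / 2) ^ 2) := Real.le_sqrt_of_sq_le (by nlinarith)
  rw [le_div_iff₀ hs]
  rcases le_total ε σ with h | h <;> nlinarith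

theorem tendsto_sq_sub_of_eventually_bounds {high low : ℝ → EReal} {κ σ : ℝ}
    (hhigh : ∀ ε > 0, ∀ᶠ δ in nhdsWithin (0 : ℝ) (Ioi 0),
      ((κ + √(2 * δ) * (σ - ε) : ℝ) : EReal) ≤ high δ ∧
        high δ ≤ ((κ + √(2 * δ) * (σ + ε) : ℝ) : EReal))
    (hlow : ∀ ε > 0, ∀ᶠ δ in nhdsWithin (0 : ℝ) (Ioi 0),
      ((κ - √(2 * δ) * (σ + ε) : ℝ) : EReal) ≤ low δ ∧
        low δ ≤ ((κ - √(2 * δ) * (σ - ε) : ℝ) : EReal)) :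
    Tendsto (fun δ : ℝ => ((((4 * δ)⁻¹ : ℝ)) : EReal) *
      ((high δ - low δ) * (high δ - low δ)))
      (nhdsWithin 0 (Ioi 0)) (nhds ((2 * σ ^ 2 : ℝ) : EReal)) := by
  have hcoe : ∀ {x : EReal} {a b : ℝ}, (a : EReal) ≤ x → x ≤ (b : EReal) →
      ((x.toReal : ℝ) : EReal) = x := fun h1 h2 =>
    EReal.coe_toReal (ne_top_of_le_ne_top (EReal.coe_ne_top _) h2)
      (ne_bot_of_le_ne_bot (EReal.coe_ne_bot _) h1)
  have hpos : ∀ᶠ δ in nhdsWithin (0 : ℝ) (Ioi 0), 0 < √(2 * δ) := by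
    filter_upwards [self_mem_nhdsWithin] with δ hδ
    exact Real.sqrt_pos.2 (mul_pos two_pos hδ)
  have ha : Tendsto (fun δ => ((high δ).toReal - κ) / √(2 * δ)) (nhdsWithin (0 : ℝ) (Ioi 0))
      (nhds σ) := by
    rw [Metric.tendsto_nhds]
    intro ε hε
    filter_upwards [hhigh (ε / 2) (half_pos hε), hpos] with δ h hs
    rw [← hcoe h.1 h.2, EReal.coe_le_coe_iff, EReal.coe_le_coe_iff] at h
    rw [Real.dist_eq, abs_lt, lt_sub_iff_add_lt, sub_lt_iff_lt_add, lt_div_iff₀ hs, div_lt_iff₀ hs]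
    constructor <;> nlinarith
  have hb : Tendsto (fun δ => ((low δ).toReal - κ) / √(2 * δ)) (nhdsWithin (0 : ℝ) (Ioi 0))
      (nhds (-σ)) := by
    rw [Metric.tendsto_nhds]
    intro ε hε
    filter_upwards [hlow (ε / 2) (half_pos hε), hpos] with δ h hs
    rw [← hcoe h.1 h.2, EReal.coe_le_coe_iff, EReal.coe_le_coe_iff] at h
    rw [Real.dist_eq, abs_lt, lt_sub_iff_add_lt, sub_lt_iff_lt_add, lt_div_iff₀ hs, div_lt_iff₀ hs]
    constructor <;> nlinarith
  have hlim : 2 * σ ^ 2 = (σ - -σ) ^ 2 / 2 := by ring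
  rw [hlim]
  refine Tendsto.congr' ?_
    ((continuous_coe_real_ereal.tendsto _).comp (((ha.sub hb).pow 2).div_const 2))
  filter_upwards [hhigh 1 one_pos, hlow 1 one_pos, self_mem_nhdsWithin] with δ h1 h2 hδ
  have hδ' : (0 : ℝ) < δ := hδ
  have hs : √(2 * δ) ^ 2 = 2 * δ := Real.sq_sqrt (by positivity)
  rw [← hcoe h1.1 h1.2, ← hcoe h2.1 h2.2]
  simp only [Function.comp_apply]
  norm_cast
  rw [← sub_div, div_pow, hs]
  field_simp
  ring

/-- First-order attainment: along either sign `a` of the direction `f θ0`, some perturbation of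
`χ²`-size at most `δ` moves the mean of `f` by nearly `√(2δ)` times its standard deviation. -/
theorem eventually_exists_perturbation_ge {U : Type*} [MeasurableSpace U] {μ : Measure U}
    [IsProbabilityMeasure μ] {S : Type*} [Fintype S] [DecidableEq S]
    {E : Type*} [NormedAddCommGroup E] [NormedSpace ℝ E] {Θ : Set E} {θ0 : E}
    (hint : θ0 ∈ interior Θ) {h : E → S → U → ℝ} {f : E → U → ℝ}
    (hfm : Measurable (f θ0)) (hf2 : ∀ θ, MemLp (f θ) 2 μ)
    (hhm : ∀ s, Measurable (h θ0 s)) (hh2 : ∀ θ s, MemLp (h θ s) 2 μ)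
    (hf0 : ∫ u, f θ0 u ∂μ = 0) (hh0 : ∀ s, ∫ u, h θ0 s u ∂μ = 0)
    (hfL : Tendsto (fun θ => ∫ u, (f θ u - f θ0 u) ^ 2 ∂μ) (nhdsWithin θ0 Θ) (nhds 0))
    (hhL : ∀ s, Tendsto (fun θ => ∫ u, (h θ s u - h θ0 s u) ^ 2 ∂μ) (nhdsWithin θ0 Θ) (nhds 0))
    (hV : (Matrix.of fun s t => ∫ u, h θ0 s u * h θ0 t u ∂μ).det ≠ 0)
    {H' : E →L[ℝ] (S → ℝ)} (hH : HasFDerivAt (fun θ s => ∫ u, h θ s u ∂μ) H' θ0)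
    (hq : HasFDerivAt (fun θ => ∫ u, f θ u ∂μ) (0 : E →L[ℝ] ℝ) θ0)
    {τ : E} (hτ : ∀ s, H' τ s = -∫ u, f θ0 u * h θ0 s u ∂μ) {a : ℝ} (ha : |a| = 1)
    {ε : ℝ} (hε : 0 < ε) :
    ∀ᶠ δ in nhdsWithin (0 : ℝ) (Ioi 0), ∃ θ ∈ Θ, ∃ m : U → ℝ, Measurable m ∧
      (∃ K, ∀ u, |m u| ≤ K) ∧ (∀ u, -1 ≤ m u) ∧ ∫ u, m u ∂μ = 0 ∧ ∫ u, m u ^ 2 ∂μ ≤ 2 * δ ∧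
      (∀ s, ∫ u, h θ s u ∂μ + ∫ u, m u * h θ s u ∂μ = 0) ∧
      √(2 * δ) * (√(∫ u, f θ0 u ^ 2 ∂μ) - ε) ≤
        a * (∫ u, f θ u ∂μ + ∫ u, m u * f θ u ∂μ) := by
  set σ := √(∫ u, f θ0 u ^ 2 ∂μ) with hσ
  have hσ2 : ∫ u, f θ0 u ^ 2 ∂μ = σ ^ 2 :=
    (Real.sq_sqrt (integral_nonneg fun u => sq_nonneg _)).symm
  have hσ0 : 0 ≤ σ := Real.sqrt_nonneg _
  have hp : 0 < σ ^ 2 + (ε / 2) ^ 2 := by positivity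
  set q := √(σ ^ 2 + (ε / 2) ^ 2) with hqdef
  have hq0 : 0 < q := Real.sqrt_pos.2 hp
  have hqq : q ^ 2 = σ ^ 2 + (ε / 2) ^ 2 := Real.sq_sqrt hp.le
  have ha2 : a * a = 1 := by rw [← abs_mul_abs_self, ha, one_mul]
  have ht : Tendsto (fun δ : ℝ => a * (√(2 * δ) / q)) (nhdsWithin 0 (Ioi 0))
      (nhdsWithin 0 {0}ᶜ) := by
    refine tendsto_nhdsWithin_iff.2 ⟨?_, ?_⟩
    · have : Continuous fun δ : ℝ => a * (√(2 * δ) / q) := by fun_prop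
      simpa using (this.tendsto 0).mono_left nhdsWithin_le_nhds
    · filter_upwards [self_mem_nhdsWithin] with δ hδ
      have : 0 < √(2 * δ) := Real.sqrt_pos.2 (mul_pos two_pos hδ)
      exact mul_ne_zero (by rintro rfl; simp at ha) (div_pos this hq0).ne'
  filter_upwards [ht.eventually (eventually_exists_perturbation hint hfm hf2 hhm hh2 hf0 hh0 hfL
    hhL hV hH hq hτ (show 0 < (ε / 2) ^ 2 by positivity)), self_mem_nhdsWithin] with δ h1 hδ
  obtain ⟨θ, hθ, m, hm, hK, hm1, hm0, hms, hmh, hmf⟩ := h1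
  have hδ' : (0 : ℝ) < δ := hδ
  have hs : √(2 * δ) ^ 2 = 2 * δ := Real.sq_sqrt (by positivity)
  refine ⟨θ, hθ, m, hm, hK, hm1, hm0, hms.trans (le_of_eq ?_), hmh, ?_⟩
  · rw [hσ2, ← hqq, mul_pow, div_pow, hs, sq a, ha2]
    field_simp
  · have hr : 0 ≤ √(2 * δ) / q := by positivity
    rw [abs_mul, ha, one_mul, abs_of_nonneg hr, hσ2] at hmf
    set X := ∫ u, f θ u ∂μ + ∫ u, m u * f θ u ∂μ
    have h2 : |a * X - √(2 * δ) / q * σ ^ 2| ≤ (ε / 2) ^ 2 * (√(2 * δ) / q) := by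
      have : a * X - √(2 * δ) / q * σ ^ 2 = a * (X - a * (√(2 * δ) / q) * σ ^ 2) := by
        linear_combination √(2 * δ) / q * σ ^ 2 * ha2
      rwa [this, abs_mul, ha, one_mul]
    have h3 := mul_le_mul_of_nonneg_left (sub_le_div_sqrt hσ0 hε) (Real.sqrt_nonneg (2 * δ))
    have h4 : √(2 * δ) * ((σ ^ 2 - (ε / 2) ^ 2) / q) =
        √(2 * δ) / q * σ ^ 2 - (ε / 2) ^ 2 * (√(2 * δ) / q) := by ring
    rw [← hqdef, h4] at h3
    linarith [(abs_le.1 h2).1]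

section Feasible

variable {U : Type*} [MeasurableSpace U] {dθ d2 d4 : ℕ} {Fstar F : Measure U}
  {g2 : U → (Fin dθ → ℝ) → Fin d2 → ℝ} {g4 : U → (Fin dθ → ℝ) → Fin d4 → ℝ}
  {k : U → (Fin dθ → ℝ) → ℝ} {Θ : Set (Fin dθ → ℝ)} {P20 : Fin d2 → ℝ} {δ : ℝ}

theorem feasible_gChi_iff {θ : Fin dθ → ℝ} :
    Feasible chiSq Fstar (gChi g2 g4) δ θ () (PChi P20) F ↔
      IsProbabilityMeasure F ∧ Dphi chiSq Fstar F ≤ ENNReal.ofReal δ ∧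
        ∀ s, Integrable (fun u => hFun g2 g4 P20 u θ s) F ∧
          ∫ u, hFun g2 g4 P20 u θ s ∂F = 0 := by
  refine and_congr_right fun hF => and_congr_right fun _ => ?_
  simp only [ConstraintsHold, GIntegrable, gChi, PChi, hFun, Sum.forall, IsEmpty.forall_iff,
    Sum.elim_inl, Sum.elim_inr, true_and, forall_and]
  constructor
  · rintro ⟨⟨h2, h4⟩, h2', h4'⟩
    refine ⟨⟨fun i => (h2 i).sub (integrable_const _), h4⟩, fun i => ?_, h4'⟩
    rw [integral_sub (h2 i) (integrable_const _), h2' i]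
    simp
  · rintro ⟨⟨h2, h4⟩, h2', h4'⟩
    have h2i : ∀ i, Integrable (fun u => g2 u θ i) F := fun i =>
      ((h2 i).add (integrable_const (P20 i))).congr (ae_of_all _ fun u => by simp)
    refine ⟨⟨h2i, h4⟩, fun i => ?_, h4'⟩
    have := h2' i
    rw [integral_sub (h2i i) (integrable_const _)] at this
    simpa [sub_eq_zero] using this

theorem le_chiHighValue {θ : Fin dθ → ℝ} (hθ : θ ∈ Θ)
    (hF : Feasible chiSq Fstar (gChi g2 g4) δ θ () (PChi P20) F)
    (hk : Integrable (fun u => k u θ) F) {x : ℝ} (hx : x ≤ ∫ u, k u θ ∂F) :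
    (x : EReal) ≤ chiHighValue Fstar g2 g4 k Θ P20 δ := by
  have h : ((∫ u, k u θ ∂F : ℝ) : EReal) ≤
      kappaHigh chiSq Fstar (gChi g2 g4) (kChi k) δ θ () (PChi P20) :=
    le_sSup ⟨F, hF, hk, rfl⟩
  exact (EReal.coe_le_coe_iff.2 hx).trans (le_iSup₂_of_le θ hθ h)

theorem chiLowValue_le {θ : Fin dθ → ℝ} (hθ : θ ∈ Θ)
    (hF : Feasible chiSq Fstar (gChi g2 g4) δ θ () (PChi P20) F)
    (hk : Integrable (fun u => k u θ) F) {x : ℝ} (hx : ∫ u, k u θ ∂F ≤ x) :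
    chiLowValue Fstar g2 g4 k Θ P20 δ ≤ (x : EReal) := by
  have h : kappaLow chiSq Fstar (gChi g2 g4) (kChi k) δ θ () (PChi P20) ≤
      ((∫ u, k u θ ∂F : ℝ) : EReal) :=
    sInf_le ⟨F, hF, hk, rfl⟩
  exact (iInf₂_le_of_le θ hθ h).trans (EReal.coe_le_coe_iff.2 hx)

theorem chiHighValue_le {x : ℝ} (h : ∀ θ ∈ Θ, ∀ F,
    Feasible chiSq Fstar (gChi g2 g4) δ θ () (PChi P20) F →
    Integrable (fun u => k u θ) F → ∫ u, k u θ ∂F ≤ x) :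
    chiHighValue Fstar g2 g4 k Θ P20 δ ≤ (x : EReal) := by
  refine iSup₂_le fun θ hθ => sSup_le ?_
  rintro _ ⟨F, hF, hk, rfl⟩
  exact EReal.coe_le_coe_iff.2 (h θ hθ F hF hk)

theorem le_chiLowValue {x : ℝ} (h : ∀ θ ∈ Θ, ∀ F,
    Feasible chiSq Fstar (gChi g2 g4) δ θ () (PChi P20) F →
    Integrable (fun u => k u θ) F → x ≤ ∫ u, k u θ ∂F) :
    (x : EReal) ≤ chiLowValue Fstar g2 g4 k Θ P20 δ := by
  refine le_iInf₂ fun θ hθ => le_sInf ?_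
  rintro _ ⟨F, hF, hk, rfl⟩
  exact EReal.coe_le_coe_iff.2 (h θ hθ F hF hk)

end Feasible

end CFSens

/-- **Theorem 5: local sensitivity, explicit-dependence case.**
Under χ²-divergence, Assumptions Φ(ii), M(i), M(iv) and the GMM-type regularity
conditions, the local sensitivity `s = lim_{δ↓0} (κ̄(N_δ) - κ̲(N_δ))²/(4δ)` exists and
equals `2 E^{F*}[ι(U)²]` with `ι(u) = Πk₀(u) - J(H'V⁻¹H)⁻¹H'V⁻¹h₀(u)`. -/
theorem local_sensitivity_explicit
    {U : Type*} [MeasurableSpace U] {dθ d2 d4 : ℕ}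
    (Fstar : Measure U) [IsProbabilityMeasure Fstar]
    (g2 : U → (Fin dθ → ℝ) → Fin d2 → ℝ) (g4 : U → (Fin dθ → ℝ) → Fin d4 → ℝ)
    (k : U → (Fin dθ → ℝ) → ℝ)
    (Θ : Set (Fin dθ → ℝ)) (P20 : Fin d2 → ℝ)
    -- Assumption Φ(ii) for χ²: finite second moments under F*
    (hmk : ∀ θ : Fin dθ → ℝ, Measurable (fun u => k u θ))
    (hmh : ∀ (θ : Fin dθ → ℝ) (s : Fin d2 ⊕ Fin d4),
      Measurable (fun u => hFun g2 g4 P20 u θ s))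
    (hk2 : ∀ θ : Fin dθ → ℝ, Integrable (fun u => (k u θ) ^ 2) Fstar)
    (hh2 : ∀ (θ : Fin dθ → ℝ) (s : Fin d2 ⊕ Fin d4),
      Integrable (fun u => (hFun g2 g4 P20 u θ s) ^ 2) Fstar)
    -- Assumption M(i) for χ²: L²(F*)-continuity in θ
    (hkL2 : ∀ θ0 ∈ Θ, Tendsto (fun θ' => ∫ u, (k u θ' - k u θ0) ^ 2 ∂Fstar)
      (nhdsWithin θ0 Θ) (nhds 0))
    (hhL2 : ∀ θ0 ∈ Θ, ∀ s : Fin d2 ⊕ Fin d4,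
      Tendsto (fun θ' => ∫ u, (hFun g2 g4 P20 u θ' s - hFun g2 g4 P20 u θ0 s) ^ 2 ∂Fstar)
        (nhdsWithin θ0 Θ) (nhds 0))
    -- Assumption M(iv)
    (hM4 : IsCompact Θ)
    -- GMM-type regularity conditions
    (θstar : Fin dθ → ℝ) (hint : θstar ∈ interior Θ)
    (hsolve : ∀ s, ∫ u, hFun g2 g4 P20 u θstar s ∂Fstar = 0)
    (huniq : ∀ θ ∈ Θ, (∀ s, ∫ u, hFun g2 g4 P20 u θ s ∂Fstar = 0) → θ = θstar)
    (H : Matrix (Fin d2 ⊕ Fin d4) (Fin dθ) ℝ)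
    (hHdiff : HasFDerivAt (fun θ' => (fun s => ∫ u, hFun g2 g4 P20 u θ' s ∂Fstar))
        (LinearMap.toContinuousLinearMap (Matrix.mulVecLin H)) θstar)
    (hHcont : ContDiffAt ℝ 1 (fun θ' => (fun s => ∫ u, hFun g2 g4 P20 u θ' s ∂Fstar)) θstar)
    (hHrank : H.rank = dθ)
    (V : Matrix (Fin d2 ⊕ Fin d4) (Fin d2 ⊕ Fin d4) ℝ)
    (hVint : ∀ s t, Integrable (fun u => hFun g2 g4 P20 u θstar s * hFun g2 g4 P20 u θstar t) Fstar)
    (hVval : ∀ s t, V s t = ∫ u, hFun g2 g4 P20 u θstar s * hFun g2 g4 P20 u θstar t ∂Fstar)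
    (hVpd : V.PosDef)
    (J : Fin dθ → ℝ)
    (hJdiff : HasFDerivAt (fun θ' => (fun _ : Fin 1 => ∫ u, k u θ' ∂Fstar))
        (LinearMap.toContinuousLinearMap (Matrix.mulVecLin (Matrix.of (fun _ : Fin 1 => J)))) θstar)
    (hJcont : ContDiffAt ℝ 1 (fun θ' => ∫ u, k u θ' ∂Fstar) θstar) :
    Tendsto (fun δ : ℝ => ((((4 * δ)⁻¹ : ℝ)) : EReal) *
        ((chiHighValue Fstar g2 g4 k Θ P20 δ - chiLowValue Fstar g2 g4 k Θ P20 δ) *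
         (chiHighValue Fstar g2 g4 k Θ P20 δ - chiLowValue Fstar g2 g4 k Θ P20 δ)))
      (nhdsWithin 0 (Set.Ioi 0))
      (nhds (((2 * ∫ u, (influence Fstar k (hFun g2 g4 P20) θstar H V J u) ^ 2 ∂Fstar : ℝ))
        : EReal)) := by
  set κ := ∫ u, k u θstar ∂Fstar with hκ
  set c : Fin d2 ⊕ Fin d4 → ℝ := fun s => ∫ u, k u θstar * hFun g2 g4 P20 u θstar s ∂Fstar with hc
  set l := multiplier H V c J with hl
  let h : (Fin dθ → ℝ) → Fin d2 ⊕ Fin d4 → U → ℝ := fun θ s u => hFun g2 g4 P20 u θ s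
  let f : (Fin dθ → ℝ) → U → ℝ := fun θ u => (k u θ - κ) + ∑ s, (-l s) * h θ s u
  have hinf : influence Fstar k (hFun g2 g4 P20) θstar H V J = f θstar := by
    funext u
    have := dot_multiplier (H := H) hVpd c J (hFun g2 g4 P20 u θstar)
    rw [influence, sub_sub, ← this]
    simp only [f, h, dot, neg_mul, Finset.sum_neg_distrib, sub_eq_add_neg, hκ, hl]
  have hHinj : Function.Injective H.mulVec := mulVec_injective_of_rank_eq (by simpa using hHrank)
  have hθ : θstar ∈ Θ := interior_subset hint
  have hh2' : ∀ θ s, MemLp (h θ s) 2 Fstar := fun θ s =>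
    (memLp_two_iff_integrable_sq (hmh θ s).aestronglyMeasurable).2 (hh2 θ s)
  have hk2' : ∀ θ, MemLp (fun u => k u θ) 2 Fstar := fun θ =>
    (memLp_two_iff_integrable_sq (hmk θ).aestronglyMeasurable).2 (hk2 θ)
  have hkκ : ∀ θ, MemLp (fun u => k u θ - κ) 2 Fstar := fun θ =>
    (hk2' θ).sub (memLp_const κ)
  have hf2 : ∀ θ, MemLp (f θ) 2 Fstar := fun θ => memLp_lincomb _ (hkκ θ) (hh2' θ)
  have hfm : Measurable (f θstar) :=
    ((hmk θstar).sub_const κ).add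
      (Finset.measurable_sum _ fun s _ => (hmh θstar s).const_mul (-l s))
  have hfint : ∀ θ, ∫ u, f θ u ∂Fstar =
      ∫ u, k u θ ∂Fstar - κ + ∑ s, (-l s) * ∫ u, h θ s u ∂Fstar := fun θ => by
    rw [integral_lincomb _ ((hkκ θ).integrable one_le_two)
      fun s => (hh2' θ s).integrable one_le_two,
      integral_sub ((hk2' θ).integrable one_le_two) (integrable_const _)]
    simp
  have hf0 : ∫ u, f θstar u ∂Fstar = 0 := by
    rw [hfint]
    simp [h, hsolve, hκ]
  have hfL : Tendsto (fun θ => ∫ u, (f θ u - f θstar u) ^ 2 ∂Fstar)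
      (nhdsWithin θstar Θ) (nhds 0) := by
    refine (tendsto_integral_lincomb_sq (b := fun θ u => k u θ - k u θstar)
      (B := fun θ s u => h θ s u - h θstar s u) (fun s => -l s)
      (fun θ => (hk2' θ).sub (hk2' θstar)) (fun θ s => (hh2' θ s).sub (hh2' θstar s))
      (hkL2 θstar hθ) (hhL2 θstar hθ)).congr fun θ => ?_
    refine integral_congr_ae (ae_of_all _ fun u => ?_)
    simp only [f, mul_sub, Finset.sum_sub_distrib]
    ring
  have hq : HasFDerivAt (fun θ => ∫ u, f θ u ∂Fstar) (0 : (Fin dθ → ℝ) →L[ℝ] ℝ) θstar := by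
    have h1 := hasFDerivAt_pi'.1 hJdiff 0
    have h2 := fun s => (hasFDerivAt_pi'.1 hHdiff s).const_mul (-l s)
    have h3 := (h1.sub_const κ).add (HasFDerivAt.fun_sum fun s (_ : s ∈ Finset.univ) => h2 s)
    simp only [hfint]
    refine h3.congr_fderiv ?_
    refine ContinuousLinearMap.ext fun v => ?_
    have h4 : J ⬝ᵥ v = l ⬝ᵥ H.mulVec v := by
      rw [Matrix.dotProduct_mulVec, ← Matrix.mulVec_transpose,
        transpose_mulVec_multiplier hVpd hHinj c J]
    simp [Matrix.mulVec, dotProduct] at h4 ⊢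
    linarith
  have hV : (Matrix.of fun s t => ∫ u, h θstar s u * h θstar t u ∂Fstar) = V := by
    ext s t
    exact (hVval s t).symm
  have hτ : ∀ s, (LinearMap.toContinuousLinearMap (Matrix.mulVecLin H)) (-adjustment H V c J) s =
      -∫ u, f θstar u * h θstar s u ∂Fstar := by
    intro s
    have h1 := congrFun (mulVec_multiplier (H := H) hVpd c J) s
    rw [integral_lincomb_mul _ (hkκ θstar) (hh2' θstar) (hh2' θstar s)]
    have h2 : ∫ u, (k u θstar - κ) * h θstar s u ∂Fstar = c s := by
      have h4 : Integrable (fun u => k u θstar * h θstar s u) Fstar :=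
        (hk2' θstar).integrable_mul (hh2' θstar s)
      simp_rw [sub_mul]
      rw [integral_sub h4 (((hh2' θstar s).integrable one_le_two).const_mul κ),
        integral_const_mul]
      simp [h, hsolve, hc]
    have h3 : ∑ t, (-l t) * ∫ u, h θstar t u * h θstar s u ∂Fstar = -(V.mulVec l s) := by
      simp only [Matrix.mulVec, dotProduct, hVval, neg_mul, Finset.sum_neg_distrib, h]
      congr 1
      refine Finset.sum_congr rfl fun t _ => ?_
      rw [mul_comm]
      congr 2
      funext u
      ring
    rw [h2, h3, hl, h1]
    simp [Matrix.mulVec_neg]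
  have hind : Topology.IsInducing (LinearMap.toContinuousLinearMap (Matrix.mulVecLin H)) :=
    (LinearMap.isClosedEmbedding_of_injective (f := Matrix.mulVecLin H)
      (LinearMap.ker_eq_bot.2 hHinj)).isInducing
  have hfk : ∀ θ (F : Measure U), IsProbabilityMeasure F → Integrable (fun u => k u θ) F →
      (∀ s, Integrable (h θ s) F ∧ ∫ u, h θ s u ∂F = 0) → ∫ u, f θ u ∂F = ∫ u, k u θ ∂F - κ := by
    intro θ F hP hk hF
    have hki : Integrable (fun u => k u θ - κ) F := hk.sub (integrable_const κ)
    rw [integral_lincomb _ hki fun s => (hF s).1,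
      integral_sub hk (integrable_const _)]
    simp [fun s => (hF s).2]
  have hup : ∀ ε > 0, ∀ᶠ δ in nhdsWithin (0 : ℝ) (Ioi 0), ∀ θ ∈ Θ, ∀ F,
      Feasible chiSq Fstar (gChi g2 g4) δ θ () (PChi P20) F → Integrable (fun u => k u θ) F →
      |∫ u, k u θ ∂F - κ| ≤ √(2 * δ) * (√(∫ u, f θstar u ^ 2 ∂Fstar) + ε) := by
    intro ε hε
    filter_upwards [eventually_abs_perturbation_le hM4 hθ hf2 hh2' hf0 hsolve huniq hfL hhL2
      hHdiff hind hq hε, self_mem_nhdsWithin] with δ hb hδ θ hθΘ F hF hk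
    rw [feasible_gChi_iff] at hF
    obtain ⟨hP, hD, hF⟩ := hF
    obtain ⟨m, hm, hm0, hmδ, hmF⟩ := exists_perturbation_of_Dphi_le (le_of_lt hδ) hD
    have := hb θ hθΘ m hm hmδ fun s => by rw [← hmF _ (hh2' θ s)]; exact (hF s).2
    rwa [← hmF _ (hf2 θ), hfk θ F hP hk hF] at this
  have hdown : ∀ a : ℝ, |a| = 1 → ∀ ε > 0, ∀ᶠ δ in nhdsWithin (0 : ℝ) (Ioi 0),
      ∃ θ ∈ Θ, ∃ F, Feasible chiSq Fstar (gChi g2 g4) δ θ () (PChi P20) F ∧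
        Integrable (fun u => k u θ) F ∧
        √(2 * δ) * (√(∫ u, f θstar u ^ 2 ∂Fstar) - ε) ≤ a * (∫ u, k u θ ∂F - κ) := by
    intro a ha ε hε
    filter_upwards [eventually_exists_perturbation_ge hint hfm hf2 (hmh θstar) hh2' hf0 hsolve hfL
      (hhL2 θstar hθ) (hV ▸ hVpd.det_pos.ne') hHdiff hq hτ ha hε] with δ hb
    obtain ⟨θ, hθΘ, m, hm, ⟨K, hK⟩, hm1, hm0, hmδ, hmh, hmf⟩ := hb
    obtain ⟨F, hP, hD, hmF⟩ := exists_measure_of_perturbation hm hK hm1 hm0 hmδ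
    have hF : ∀ s, Integrable (h θ s) F ∧ ∫ u, h θ s u ∂F = 0 := fun s =>
      ⟨(hmF _ (hh2' θ s)).1, by rw [(hmF _ (hh2' θ s)).2, hmh s]⟩
    have hk := (hmF _ (hk2' θ)).1
    refine ⟨θ, hθΘ, F, feasible_gChi_iff.2 ⟨hP, hD, hF⟩, hk, ?_⟩
    rwa [← hfk θ F hP hk hF, (hmF _ (hf2 θ)).2]
  rw [hinf, ← Real.sq_sqrt (integral_nonneg fun u => sq_nonneg (f θstar u))]
  refine tendsto_sq_sub_of_eventually_bounds (κ := κ) (fun ε hε => ?_) (fun ε hε => ?_)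
  · filter_upwards [hup ε hε, hdown 1 (by simp) ε hε] with δ h1 h2
    obtain ⟨θ, hθΘ, F, hF, hk, hle⟩ := h2
    exact ⟨le_chiHighValue hθΘ hF hk (by linarith),
      chiHighValue_le fun θ hθ F hF hk => by linarith [(abs_le.1 (h1 θ hθ F hF hk)).2]⟩
  · filter_upwards [hup ε hε, hdown (-1) (by simp) ε hε] with δ h1 h2
    obtain ⟨θ, hθΘ, F, hF, hk, hle⟩ := h2
    exact ⟨le_chiLowValue fun θ hθ F hF hk => by linarith [(abs_le.1 (h1 θ hθ F hF hk)).1],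
      chiLowValue_le hθΘ hF hk (by linarith)⟩
end
end
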